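/- There exists a flow on ℝ³ with uniformly bounded trajectories and no compact trajectories: a continuous map φ : ℝ × ℝ³ → ℝ³ with φ(0,x) = x and φ(s+t,x) = φ(s,φ(t,x)) for all s, t ∈ ℝ and x ∈ ℝ³, such that φ(T,x) ≠ x for every x ∈ ℝ³ and every T ≠ 0 (so φ has no rest points and no periodic orbits), and there exists a constant K > 0 with ‖φ(t,x) − x‖ ≤ K for all t ∈ ℝ and x ∈ ℝ³. (Kuperberg–Reed 1989, improving their 1981 result via the Schweitzer plug.) -/

import Mathlib

open Set Filter Topology Metric
open scoped NNReal

namespace KR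

section Flow
variable {E : Type*} [NormedAddCommGroup E] [NormedSpace ℝ E] 

theorem flow_local [CompleteSpace E] {v : E → E} {K : ℝ≥0} (hv : LipschitzWith K v) {M : ℝ≥0} (hM : ∀ x, ‖v x‖ ≤ M)
    (x : E) (n : ℕ) : ∃ γ : ℝ → E, γ 0 = x ∧ ∀ t ∈ Ioo (-(n:ℝ)) n, HasDerivAt γ (v (γ t)) t := by
  have h0 : (0:ℝ) ∈ Icc (-(n:ℝ)) n := by constructor <;> simp
  have := IsPicardLindelof.of_time_independent (f := v) (t₀ := (⟨0, h0⟩ : Icc (-(n:ℝ)) n)) (x₀ := x)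
    (a := M * n) (r := 0) (L := M) (K := K) (fun y _ => hM y) hv.lipschitzOnWith (by simp)
  obtain ⟨γ, h1, h2⟩ := this.exists_eq_forall_mem_Icc_hasDerivWithinAt₀
  exact ⟨γ, h1, fun t ht => (h2 t (Ioo_subset_Icc_self ht)).hasDerivAt (Icc_mem_nhds ht.1 ht.2)⟩

/-- uniqueness on open intervals -/
theorem sol_unique {v : E → E} {K : ℝ≥0} (hv : LipschitzWith K v) {γ δ : ℝ → E} {a b t₀ : ℝ}
    (ht : t₀ ∈ Ioo a b) (h1 : ∀ t ∈ Ioo a b, HasDerivAt γ (v (γ t)) t)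
    (h2 : ∀ t ∈ Ioo a b, HasDerivAt δ (v (δ t)) t) (h : γ t₀ = δ t₀) : EqOn γ δ (Ioo a b) :=
  ODE_solution_unique_of_mem_Ioo (v := fun _ => v) (s := fun _ => univ) (fun _ _ => hv.lipschitzOnWith) ht
    (fun t ht => ⟨h1 t ht, trivial⟩) (fun t ht => ⟨h2 t ht, trivial⟩) h

theorem sol_dist {v : E → E} {K : ℝ≥0} (hv : LipschitzWith K v) {γ δ : ℝ → E} 
    (h1 : ∀ t, HasDerivAt γ (v (γ t)) t) (h2 : ∀ t, HasDerivAt δ (v (δ t)) t) (t : ℝ) :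
    dist (γ t) (δ t) ≤ dist (γ 0) (δ 0) * Real.exp (K * |t|) := by
  have key : ∀ (v : E → E) (hv : LipschitzWith K v) (γ δ : ℝ → E) 
    (h1 : ∀ t, HasDerivAt γ (v (γ t)) t) (h2 : ∀ t, HasDerivAt δ (v (δ t)) t) (t : ℝ), 0 ≤ t → 
    dist (γ t) (δ t) ≤ dist (γ 0) (δ 0) * Real.exp (K * t) := by
    intro v hv γ δ h1 h2 t ht
    have := dist_le_of_trajectories_ODE (v := fun _ => v) (K := K) (f := γ) (g := δ) (a := 0) (b := t) (δ := dist (γ 0) (δ 0))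
      (fun _ => hv) (fun s _ => (h1 s).continuousAt.continuousWithinAt) (fun s _ => (h1 s).hasDerivWithinAt)
      (fun s _ => (h2 s).continuousAt.continuousWithinAt) (fun s _ => (h2 s).hasDerivWithinAt) le_rfl t ⟨ht, le_rfl⟩
    simpa using this
  rcases le_total 0 t with h | h
  · rw [abs_of_nonneg h]; exact key v hv γ δ h1 h2 t h
  · have := key (fun x => - v x) (hv.neg) (fun s => γ (-s)) (fun s => δ (-s))
      (fun s => by simpa [Function.comp_def] using (h1 (-s)).scomp s (hasDerivAt_neg s)) (fun s => by simpa [Function.comp_def] using (h2 (-s)).scomp s (hasDerivAt_neg s)) (-t) (by linarith)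
    rw [abs_of_nonpos h]; simpa using this

/-- The flow property bundle. -/
structure IsFlowOf (v : E → E) (φ : ℝ → E → E) : Prop where
  cont : Continuous (fun p : ℝ × E => φ p.1 p.2)
  zero : ∀ x, φ 0 x = x
  add : ∀ s t x, φ (s + t) x = φ s (φ t x)
  deriv : ∀ t x, HasDerivAt (fun t => φ t x) (v (φ t x)) t
  lip : ∃ K : ℝ≥0, LipschitzWith K v

theorem exists_flow [CompleteSpace E] {v : E → E} {K : ℝ≥0} (hv : LipschitzWith K v) {M : ℝ≥0} (hM : ∀ x, ‖v x‖ ≤ M) :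
    ∃ φ : ℝ → E → E, IsFlowOf v φ := by
  choose γ hγ0 hγ using flow_local hv hM
  let N : ℝ → ℕ := fun t => ⌈|t|⌉₊ + 1
  have hN : ∀ t, |t| < N t := fun t => by
    have := Nat.le_ceil |t|
    simp only [N]; push_cast; linarith
  have hcons : ∀ x (m n : ℕ) (t : ℝ), |t| < m → |t| < n → γ x m t = γ x n t := by
    have : ∀ x (m n : ℕ) (t : ℝ), m ≤ n → |t| < m → γ x m t = γ x n t := by
      intro x m n t hmn htm
      have hm : (m:ℝ) ≤ n := by exact_mod_cast hmn
      have h0 := abs_nonneg t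
      refine sol_unique hv (a := -(m:ℝ)) (b := m) (t₀ := 0) ⟨by linarith, by linarith⟩ (hγ x m) 
        (fun s hs => hγ x n s ⟨by linarith [hs.1], by linarith [hs.2]⟩) (by rw [hγ0, hγ0]) (abs_lt.1 htm)
    intro x m n t hm hn
    rcases le_total m n with h | h
    · exact this x m n t h hm
    · exact (this x n m t h hn).symm
  let φ : ℝ → E → E := fun t x => γ x (N t) t
  have hd : ∀ t x, HasDerivAt (fun t => φ t x) (v (φ t x)) t := by
    intro t x
    have h1 := hγ x (N t) t (abs_lt.1 (hN t))
    refine h1.congr_of_eventuallyEq ?_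
    have : ∀ᶠ s : ℝ in 𝓝 t, |s| < (N t : ℝ) := (continuous_abs.tendsto t).eventually_lt_const (hN t)
    filter_upwards [this] with s hs
    exact hcons x _ _ s (hN s) hs
  have h0 : ∀ x, φ 0 x = x := fun x => hγ0 x _
  refine ⟨φ, ?_, h0, ?_, hd, K, hv⟩
  · have hL : ∀ x s t, dist (φ s x) (φ t x) ≤ M * dist s t := by
      intro x s t
      have : LipschitzWith M (fun t => φ t x) := lipschitzWith_of_nnnorm_deriv_le (fun t => (hd t x).differentiableAt) 
        (fun t => by rw [(hd t x).deriv]; exact hM _)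
      exact this.dist_le_mul s t
    rw [continuous_iff_continuousAt]
    rintro ⟨t, x⟩
    rw [ContinuousAt, tendsto_iff_dist_tendsto_zero]
    have hb : ∀ p : ℝ × E, dist (φ p.1 p.2) (φ t x) ≤ M * dist p.1 t + dist p.2 x * Real.exp (K * |t|) := by
      intro p
      refine (dist_triangle _ (φ t p.2) _).trans (add_le_add (hL _ _ _) ?_)
      have := sol_dist hv (fun t => hd t p.2) (fun t => hd t x) t
      simpa [h0] using this
    refine squeeze_zero (fun _ => dist_nonneg) hb ?_
    have : Continuous (fun p : ℝ × E => M * dist p.1 t + dist p.2 x * Real.exp (K * |t|)) := by fun_prop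
    simpa using this.tendsto (t, x)
  · intro s t x
    have := ODE_solution_unique_univ (v := fun _ => v) (s := fun _ => univ) (K := K) (f := fun s => φ (s + t) x) (g := fun s => φ s (φ t x)) (t₀ := 0)
      (fun _ => hv.lipschitzOnWith) (fun r => ⟨(hd (r + t) x).comp_add_const r t, trivial⟩)
      (fun r => ⟨hd r _, trivial⟩) (by simp [h0])
    exact congrFun this s

/-- a curve solving the ODE on `[a,b]` follows the flow -/
theorem IsFlowOf.eq_of_Icc {v : E → E} {φ : ℝ → E → E} (h : IsFlowOf v φ) {γ : ℝ → E} {a b : ℝ}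
    (hγ : ∀ t ∈ Icc a b, HasDerivWithinAt γ (v (γ t)) (Icc a b) t) {s t : ℝ} (hs : s ∈ Icc a b) (ht : t ∈ Icc a b) :
    γ t = φ (t - s) (γ s) := by
  obtain ⟨K, hv⟩ := h.lip
  have hab : a ≤ b := hs.1.trans hs.2
  have key : ∀ t ∈ Icc a b, γ t = φ (t - a) (γ a) := by
    have hd : ∀ t, HasDerivAt (fun t => φ (t - a) (γ a)) (v (φ (t - a) (γ a))) t := fun t => 
      (h.deriv (t - a) (γ a)).comp_sub_const t a
    refine ODE_solution_unique_of_mem_Icc_right (v := fun _ => v) (s := fun _ => univ) (K := K)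
      (fun _ _ => hv.lipschitzOnWith) (fun t ht => (hγ t ht).continuousWithinAt) 
      (fun t ht => ((hγ t ⟨ht.1, ht.2.le⟩).mono_of_mem_nhdsWithin (Icc_mem_nhdsGE_of_mem ht))) (fun _ _ => trivial)
      (fun t ht => (hd t).continuousAt.continuousWithinAt) (fun t ht => (hd t).hasDerivWithinAt) (fun _ _ => trivial) (by simp [h.zero])
  rw [key t ht, key s hs, ← h.add]
  congr 1; ring

theorem IsFlowOf.eq_of_forall {v : E → E} {φ : ℝ → E → E} (h : IsFlowOf v φ) {γ : ℝ → E} {a b : ℝ}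
    (hγ : ∀ t ∈ Icc a b, HasDerivAt γ (v (γ t)) t) {s t : ℝ} (hs : s ∈ Icc a b) (ht : t ∈ Icc a b) :
    γ t = φ (t - s) (γ s) := h.eq_of_Icc (fun t ht => (hγ t ht).hasDerivWithinAt) hs ht

theorem IsFlowOf.neg_apply {v : E → E} {φ : ℝ → E → E} (h : IsFlowOf v φ) (t : ℝ) (x : E) : φ (-t) (φ t x) = x := by
  rw [← h.add]; simp [h.zero]
theorem IsFlowOf.apply_neg {v : E → E} {φ : ℝ → E → E} (h : IsFlowOf v φ) (t : ℝ) (x : E) : φ t (φ (-t) x) = x := by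
  rw [← h.add]; simp [h.zero]

end Flow
end KR

open Set Filter Topology Metric
open scoped NNReal

namespace KR

noncomputable section

section Denjoy

theorem mono_ext {ι : Type*} [Nonempty ι] (P F : ι → ℝ)
    (h : ∀ i j, P i ≤ P j → (P j - P i)/2 ≤ F j - F i ∧ F j - F i ≤ 2 * (P j - P i))
    (u : ι ≃ ι) (hP : ∀ i, P (u i) = P i + 1) (hF : ∀ i, F (u i) = F i + 1) :
    ∃ H : ℝ → ℝ, (∀ x y, x ≤ y → (y - x)/2 ≤ H y - H x ∧ H y - H x ≤ 2 * (y - x)) ∧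
      (∀ x, H (x+1) = H x + 1) ∧ ∀ i, H (P i) = F i := by
  let q : ℝ → ι → ℝ := fun x i => F i - P i / 2 + (3/2) * max (x - P i) 0
  have hq : ∀ x i j, F j - P j / 2 - (3/2) * max (P j - x) 0 ≤ q x i := by
    intro x i j
    simp only [q]
    rcases le_total (P i) (P j) with h1 | h1
    · have := (h i j h1).2
      rcases max_cases (x - P i) 0 with h2 | h2 <;> rcases max_cases (P j - x) 0 with h3 | h3 <;> linarith
    · have := (h j i h1).1
      have h2 := le_max_right (x - P i) 0
      have h3 := le_max_right (P j - x) 0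
      linarith
  have hbdd : ∀ x, BddBelow (range (q x)) := by
    intro x
    obtain ⟨j⟩ := ‹Nonempty ι›
    refine ⟨F j - P j / 2 - (3/2) * max (P j - x) 0, ?_⟩
    rintro _ ⟨i, rfl⟩
    exact hq x i j
  refine ⟨fun x => x/2 + ⨅ i, q x i, ?_, ?_, ?_⟩
  · intro x y hxy
    have h1 : ⨅ i, q x i ≤ ⨅ i, q y i := by
      refine ciInf_mono (hbdd x) (fun i => ?_)
      simp only [q]
      have : max (x - P i) 0 ≤ max (y - P i) 0 := max_le_max (by linarith) le_rfl
      linarith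
    have h2 : (⨅ i, q y i) - (3/2) * (y - x) ≤ ⨅ i, q x i := by
      refine le_ciInf (fun i => ?_)
      have h3 := ciInf_le (hbdd y) i
      have : q y i ≤ q x i + (3/2) * (y - x) := by
        simp only [q]
        rcases max_cases (x - P i) 0 with h2 | h2 <;> rcases max_cases (y - P i) 0 with h3 | h3 <;> linarith
      linarith
    constructor <;> linarith
  · intro x
    have : ⨅ i, q (x+1) i = (⨅ i, q x i) + 1/2 := by
      rw [← u.surjective.iInf_comp, ciInf_add (hbdd x)]
      congr 1; ext i
      simp only [q, hP, hF]
      rw [show x + 1 - (P i + 1) = x - P i by ring]; ring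
    simp only [this]; ring
  · intro i
    have : ⨅ j, q (P i) j = F i - P i / 2 := by
      apply le_antisymm
      · refine (ciInf_le (hbdd _) i).trans ?_
        simp [q]
      · refine le_ciInf (fun j => ?_)
        simpa using hq (P i) j i
    simp only [this]; ring

def wt (n : ℤ) : ℝ := (1/2)^n.natAbs / 3

theorem wt_pos (n : ℤ) : 0 < wt n := by unfold wt; positivity

theorem wt_sum : HasSum wt 1 := by
  have h1 : HasSum (fun n : ℕ => wt n) (2/3) := by
    have := (hasSum_geometric_of_lt_one (r := (1/2:ℝ)) (by norm_num) (by norm_num)).div_const 3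
    rw [show ((1 - 1/2 : ℝ)⁻¹ / 3) = 2/3 by norm_num] at this
    exact this
  have h2 : HasSum (fun n : ℕ => wt (-(n+1:ℤ))) (1/3) := by
    have := ((hasSum_geometric_of_lt_one (r := (1/2:ℝ)) (by norm_num) (by norm_num)).mul_left (1/2)).div_const 3
    rw [show (1/2 * (1 - 1/2 : ℝ)⁻¹ / 3) = 1/3 by norm_num] at this
    have e : (fun n : ℕ => wt (-(n+1:ℤ))) = fun n : ℕ => 1/2 * (1/2:ℝ)^n / 3 := by
      ext n
      unfold wt
      rw [show (-(n+1:ℤ)).natAbs = n + 1 by omega, pow_succ]; ring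
    rw [e]; exact this
  have := HasSum.of_nat_of_neg_add_one h1 h2
  rwa [show (2/3 + 1/3 : ℝ) = 1 by norm_num] at this

theorem wt_succ (n : ℤ) : wt n / 2 ≤ wt (n+1) ∧ wt (n+1) ≤ 2 * wt n := by
  unfold wt
  rcases le_or_gt 0 n with h | h
  · rw [show (n+1).natAbs = n.natAbs + 1 by omega, pow_succ]
    have : (0:ℝ) < (1/2)^n.natAbs := by positivity
    constructor <;> linarith
  · rw [show n.natAbs = (n+1).natAbs + 1 by omega, pow_succ]
    have : (0:ℝ) < (1/2)^(n+1).natAbs := by positivity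
    constructor <;> linarith

variable (α : ℝ)

def cnt (n : ℤ) (i : ℝ × Bool) : ℤ := if i.2 then ⌊i.1 - n * α⌋ else ⌈i.1 - n * α⌉ - 1

theorem cnt_bd (n : ℤ) (i : ℝ × Bool) : i.1 - n * α - 1 ≤ cnt α n i ∧ (cnt α n i : ℝ) ≤ i.1 - n * α := by
  unfold cnt
  split_ifs
  · exact ⟨(Int.sub_one_lt_floor _).le, Int.floor_le _⟩
  · push_cast
    exact ⟨by linarith [Int.le_ceil (i.1 - n * α)], by linarith [Int.ceil_lt_add_one (i.1 - n * α)]⟩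

theorem cnt_mono {i j : ℝ × Bool} (h : i.1 < j.1) (n : ℤ) : cnt α n i ≤ cnt α n j := by
  have h1 : (⌊i.1 - n * α⌋ : ℤ) ≤ ⌈j.1 - n * α⌉ - 1 := by
    have : (⌊i.1 - n * α⌋ : ℤ) < ⌈j.1 - n * α⌉ := by
      rw [Int.lt_ceil]
      exact (Int.floor_le _).trans_lt (by linarith)
    omega
  have h2 : ∀ x : ℝ, ⌈x⌉ - 1 ≤ ⌊x⌋ := fun x => by have := Int.ceil_le_floor_add_one x; omega
  have h3 := h2 (i.1 - n * α)
  have h4 := h2 (j.1 - n * α)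
  unfold cnt
  split_ifs <;> omega

theorem cnt_total (i j : ℝ × Bool) : (∀ n, cnt α n i ≤ cnt α n j) ∨ (∀ n, cnt α n j ≤ cnt α n i) := by
  rcases lt_trichotomy i.1 j.1 with h | h | h
  · exact Or.inl (cnt_mono α h)
  · have h2 : ∀ x : ℝ, ⌈x⌉ - 1 ≤ ⌊x⌋ := fun x => by have := Int.ceil_le_floor_add_one x; omega
    by_cases hi : i.2
    · right; intro n
      have := h2 (i.1 - n * α)
      unfold cnt; rw [← h]; split_ifs; omega
      exact this
    · left; intro n
      have := h2 (i.1 - n * α)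
      unfold cnt; rw [← h]; split_ifs
      exact this; omega
  · exact Or.inr (cnt_mono α h)

def PP (i : ℝ × Bool) : ℝ := ∑' n, wt n * (cnt α n i - cnt α n (0, true)) + 1/6

theorem PP_summable (w : ℤ → ℝ) (hw0 : ∀ n, 0 ≤ w n) (hw : Summable w) (i j : ℝ × Bool) : 
    Summable (fun n => w n * (cnt α n i - cnt α n j : ℝ)) := by
  refine Summable.of_norm_bounded (g := fun n => (|i.1 - j.1| + 1) * w n) (hw.mul_left _) (fun n => ?_)
  rw [norm_mul, Real.norm_of_nonneg (hw0 n), mul_comm]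
  refine mul_le_mul_of_nonneg_right ?_ (hw0 n)
  have h1 := cnt_bd α n i
  have h2 := cnt_bd α n j
  rw [Real.norm_eq_abs, abs_le]
  constructor
  · linarith [neg_abs_le (i.1 - j.1)]
  · linarith [le_abs_self (i.1 - j.1)]

theorem PP_sub (i j : ℝ × Bool) : PP α j - PP α i = ∑' n, wt n * (cnt α n j - cnt α n i) := by
  unfold PP
  rw [add_sub_add_right_eq_sub, ← Summable.tsum_sub (PP_summable α wt (fun n => (wt_pos n).le) wt_sum.summable _ _) (PP_summable α wt (fun n => (wt_pos n).le) wt_sum.summable _ _)]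
  congr 1; ext n; ring

def sh (t : ℝ) : (ℝ × Bool) ≃ (ℝ × Bool) := (Equiv.addRight t).prodCongr (Equiv.refl _)

@[simp] theorem sh_apply (t y : ℝ) (s : Bool) : sh t (y, s) = (y + t, s) := rfl

theorem cnt_sh (n : ℤ) (i : ℝ × Bool) : cnt α n (sh α i) = cnt α (n-1) i := by
  obtain ⟨y, s⟩ := i
  simp only [cnt, sh_apply]
  rw [show y + α - n * α = y - ((n-1 : ℤ):ℝ) * α by push_cast; ring]
  cases s <;> rfl

theorem cnt_sh1 (n : ℤ) (i : ℝ × Bool) : cnt α n (sh 1 i) = cnt α n i + 1 := by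
  obtain ⟨y, s⟩ := i
  simp only [cnt, sh_apply]
  rw [show y + 1 - n * α = y - n * α + 1 by ring, Int.floor_add_one, Int.ceil_add_one]
  cases s <;> simp

theorem PP_sh1 (i : ℝ × Bool) : PP α (sh 1 i) = PP α i + 1 := by
  have := PP_sub α i (sh 1 i)
  simp only [cnt_sh1] at this
  push_cast at this
  simp only [add_sub_cancel_left, mul_one, wt_sum.tsum_eq] at this
  linarith

theorem PP_shα_sub (i j : ℝ × Bool) : PP α (sh α j) - PP α (sh α i) = ∑' n, wt (n+1) * (cnt α n j - cnt α n i) := by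
  rw [PP_sub, ← (Equiv.addRight (1:ℤ)).tsum_eq]
  simp [cnt_sh]

theorem PP_mono {i j : ℝ × Bool} (h : ∀ n, cnt α n i ≤ cnt α n j) : PP α i ≤ PP α j := by
  have := PP_sub α i j
  have h2 : 0 ≤ ∑' n, wt n * (cnt α n j - cnt α n i : ℝ) := tsum_nonneg (fun n => mul_nonneg (wt_pos n).le (by 
    have : (cnt α n i : ℝ) ≤ cnt α n j := by exact_mod_cast h n
    linarith))
  linarith

theorem PP_slope (i j : ℝ × Bool) (h : PP α i ≤ PP α j) : 
    (PP α j - PP α i) / 2 ≤ PP α (sh α j) - PP α (sh α i) ∧ PP α (sh α j) - PP α (sh α i) ≤ 2 * (PP α j - PP α i) := by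
  have key : ∀ i j, (∀ n, cnt α n i ≤ cnt α n j) → 
    (PP α j - PP α i) / 2 ≤ PP α (sh α j) - PP α (sh α i) ∧ PP α (sh α j) - PP α (sh α i) ≤ 2 * (PP α j - PP α i) := by
    intro i j h
    have h0 : ∀ n, (0:ℝ) ≤ cnt α n j - cnt α n i := fun n => by
      have : (cnt α n i : ℝ) ≤ cnt α n j := by exact_mod_cast h n
      linarith
    have hs1 := PP_summable α wt (fun n => (wt_pos n).le) wt_sum.summable j i
    have hw1 : Summable (fun n : ℤ => wt (n+1)) := by
      have := (Equiv.addRight (1:ℤ)).summable_iff.2 wt_sum.summable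
      have e : (wt ∘ (Equiv.addRight (1:ℤ))) = fun n : ℤ => wt (n+1) := by ext n; simp
      rw [e] at this; exact this
    have hs2 : Summable (fun n : ℤ => wt (n+1) * (cnt α n j - cnt α n i : ℝ)) := 
      PP_summable α (fun n => wt (n+1)) (fun n => (wt_pos _).le) hw1 j i
    have hs3 : Summable (fun n : ℤ => wt n * (cnt α n j - cnt α n i : ℝ) / 2) := hs1.div_const 2
    have hs4 : Summable (fun n : ℤ => 2 * (wt n * (cnt α n j - cnt α n i : ℝ))) := hs1.mul_left 2
    have t1 : ∑' n, wt n * (cnt α n j - cnt α n i : ℝ) / 2 = (PP α j - PP α i) / 2 := by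
      rw [tsum_div_const, PP_sub]
    have t2 : ∑' n, 2 * (wt n * (cnt α n j - cnt α n i : ℝ)) = 2 * (PP α j - PP α i) := by
      rw [tsum_mul_left, PP_sub]
    have t3 := PP_shα_sub α i j
    have i1 : ∀ n, wt n * (cnt α n j - cnt α n i : ℝ) / 2 ≤ wt (n+1) * (cnt α n j - cnt α n i : ℝ) := fun n => by
      have := mul_le_mul_of_nonneg_right (wt_succ n).1 (h0 n)
      linarith
    have i2 : ∀ n, wt (n+1) * (cnt α n j - cnt α n i : ℝ) ≤ 2 * (wt n * (cnt α n j - cnt α n i : ℝ)) := fun n => by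
      have := mul_le_mul_of_nonneg_right (wt_succ n).2 (h0 n)
      linarith
    have j1 := Summable.tsum_le_tsum i1 hs3 hs2
    have j2 := Summable.tsum_le_tsum i2 hs2 hs4
    rw [t1, ← t3] at j1
    rw [t2, ← t3] at j2
    exact ⟨j1, j2⟩
  rcases cnt_total α i j with h1 | h1
  · exact key i j h1
  · have := key j i h1
    have h2 := PP_mono α h1
    constructor <;> linarith [this.1, this.2]

end Denjoy
end
end KR

open Set Filter Topology Metric
open scoped NNReal

namespace KR
noncomputable section
section Denjoy2

theorem PP_gap {α : ℝ} (hα : Irrational α) (n : ℤ) : PP α (n * α, true) - PP α (n * α, false) = wt n := by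
  rw [PP_sub, tsum_eq_single n]
  · simp [cnt]
  · intro m hm
    have : (⌊(n:ℝ) * α - m * α⌋ : ℤ) = ⌈(n:ℝ) * α - m * α⌉ - 1 := by
      have hne : ∀ z : ℤ, (n:ℝ) * α - m * α ≠ z := by
        intro z hz
        have h2 : Irrational (((n - m : ℤ) : ℝ) * α) := by
          refine hα.intCast_mul (sub_ne_zero.2 hm.symm)
        apply h2
        exact ⟨z, by push_cast; linarith⟩
      set x := (n:ℝ) * α - m * α
      have h1 : ⌈x⌉ = ⌊x⌋ + 1 := by
        rw [Int.ceil_eq_iff]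
        push_cast
        exact ⟨by simpa using lt_of_le_of_ne (Int.floor_le x) (fun h => hne ⌊x⌋ h.symm), (Int.lt_floor_add_one x).le⟩
      omega
    simp [cnt, this]

theorem iter_slope {H : ℝ → ℝ} (hm : StrictMono H) : ∀ n, StrictMono (H^[n]) := fun n => hm.iterate n

theorem denjoy : ∃ (H : ℝ → ℝ) (a b c : ℝ), (∀ x y, x ≤ y → (y - x)/2 ≤ H y - H x ∧ H y - H x ≤ 2 * (y - x)) ∧
    (∀ x, H (x+1) = H x + 1) ∧ (∀ k : ℕ, 0 < k → ∀ (j : ℤ) (x : ℝ), H^[k] x ≠ x + j) ∧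
    0 < H 0 ∧ H 0 < 1 ∧ 0 < c ∧ c < 1 ∧ H c = 1 ∧ 0 < a ∧ a < b ∧ b < 1 ∧
    ∀ x ∈ Icc a b, ∀ (n : ℕ) (j : ℤ), 1/12 ≤ |H^[n] x - j| ∧ 1/12 ≤ |H^[n] x - H 0 - j| ∧ 1/12 ≤ |H^[n] x - c - j| := by
  let α : ℝ := √2 - 1
  have hα : Irrational α := by
    have := irrational_sqrt_two.sub_intCast 1
    simpa [α] using this
  have hα0 : 0 < α := by
    have : (1:ℝ) < √2 := by rw [Real.lt_sqrt] <;> norm_num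
    simp only [α]; linarith
  have hα1 : α < 1/2 := by
    have : √2 < (3/2:ℝ) := by rw [Real.sqrt_lt'] <;> norm_num
    simp only [α]; linarith
  clear_value α
  have hF1 : ∀ i, PP α (sh α (sh 1 i)) = PP α (sh α i) + 1 := by
    rintro ⟨y, s⟩
    rw [← PP_sh1]; simp only [sh_apply]; congr 2; ring
  obtain ⟨H, hH, hH1, hHP⟩ := mono_ext (PP α) (fun i => PP α (sh α i)) (PP_slope α) (sh 1) (PP_sh1 α) hF1
  have hmono : StrictMono H := fun x y hxy => by have := (hH x y hxy.le).1; linarith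
  have hHz : ∀ x (j : ℤ), H (x + j) = H x + j := by
    intro x j
    induction j using Int.induction_on with
    | zero => simp
    | succ i ih => 
      push_cast at ih ⊢
      rw [← add_assoc, hH1, ih]; ring
    | pred i ih => 
      push_cast at ih ⊢
      have := hH1 (x + (-i - 1))
      rw [show x + (-i-1 : ℝ) + 1 = x + -i by ring, ih] at this; linarith
  have hHkz : ∀ (k : ℕ) x (j : ℤ), H^[k] (x + j) = H^[k] x + j := by
    intro k
    induction k with
    | zero => intro x j; simp
    | succ k ih => intro x j; rw [Function.iterate_succ_apply, hHz, ih, Function.iterate_succ_apply]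
  have hPz : ∀ (j : ℤ) y s, PP α (y + j, s) = PP α (y, s) + j := by
    intro j y s
    induction j using Int.induction_on with
    | zero => simp
    | succ i ih => 
      have := PP_sh1 α (y + i, s)
      simp only [sh_apply] at this
      push_cast at ih ⊢
      rw [← add_assoc, this, ih]; ring
    | pred i ih => 
      have := PP_sh1 α (y + (-i-1), s)
      simp only [sh_apply] at this
      push_cast at ih ⊢
      rw [show y + (-i-1 : ℝ) + 1 = y + -i by ring, ih] at this; linarith
  have hHk : ∀ (k : ℕ) y s, H^[k] (PP α (y, s)) = PP α (y + k * α, s) := by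
    intro k
    induction k with
    | zero => intro y s; simp
    | succ k ih => intro y s; rw [Function.iterate_succ_apply, hHP, sh_apply, ih]; congr 2; push_cast; ring
  have hap : ∀ k : ℕ, 0 < k → ∀ (j : ℤ) (x : ℝ), H^[k] x ≠ x + j := by
    intro k hk j x hx
    set d : ℝ := k * α - j with hd
    have hd0 : d ≠ 0 := by
      intro h0
      have : Irrational ((k:ℝ) * α) := hα.natCast_mul hk.ne'
      exact this ⟨j, by push_cast; linarith⟩
    have hiff : ∀ y, PP α (y, true) ≤ x ↔ PP α (y + d, true) ≤ x := by
      intro y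
      rw [← (hmono.iterate k).le_iff_le, hx, hHk]
      have := hPz j (y + d) true
      rw [show y + d + j = y + k * α by rw [hd]; ring] at this
      rw [this]; simp
    have hne : ∃ y, PP α (y, true) ≤ x := by
      refine ⟨0 + (⌊x - PP α (0, true)⌋ : ℤ), ?_⟩
      rw [hPz]; linarith [Int.floor_le (x - PP α (0, true))]
    have hbd : ∃ B, ∀ y, PP α (y, true) ≤ x → y ≤ B := by
      refine ⟨0 + ((⌊x - PP α (0, true)⌋ + 1 : ℤ) : ℝ), fun y hy => ?_⟩
      by_contra hlt
      push Not at hlt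
      have h1 := PP_mono α (cnt_mono α (i := (0 + ((⌊x - PP α (0, true)⌋ + 1 : ℤ) : ℝ), true)) (j := (y, true)) hlt)
      rw [hPz] at h1
      have := Int.lt_floor_add_one (x - PP α (0, true))
      push_cast at h1
      linarith
    let A : Set ℝ := {y | PP α (y, true) ≤ x}
    have hA : BddAbove A := by obtain ⟨B, hB⟩ := hbd; exact ⟨B, fun y hy => hB y hy⟩
    have hAn : A.Nonempty := hne
    have h1 : sSup A ≤ sSup A - d := csSup_le hAn (fun y hy => by
      have := le_csSup hA ((hiff y).1 hy : y + d ∈ A); linarith)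
    have h2 : sSup A ≤ sSup A + d := csSup_le hAn (fun y hy => by
      have : y - d ∈ A := (hiff (y - d)).2 (by rw [sub_add_cancel]; exact hy)
      have := le_csSup hA this; linarith)
    exact hd0 (by linarith)
  -- gaps
  let l : ℤ → ℝ := fun n => PP α (n * α, false)
  let r : ℤ → ℝ := fun n => PP α (n * α, true)
  have hlr : ∀ n, r n - l n = wt n := fun n => PP_gap hα n
  have hl : ∀ n, H (l n) = l (n+1) := fun n => by
    simp only [l]; rw [hHP, sh_apply]; congr 2; push_cast; ring
  have hr : ∀ n, H (r n) = r (n+1) := fun n => by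
    simp only [r]; rw [hHP, sh_apply]; congr 2; push_cast; ring
  have hdis : ∀ (m n j : ℤ), n * α < m * α + j → r n ≤ l m + j := by
    intro m n j h
    have := PP_mono α (cnt_mono α (i := (n * α, true)) (j := (m * α + j, false)) h)
    rwa [hPz] at this
  have hdis' : ∀ (m n j : ℤ), n * α + j < m * α → r n + j ≤ l m := by
    intro m n j h
    have := PP_mono α (cnt_mono α (i := (n * α + j, true)) (j := (m * α, false)) h)
    rwa [hPz] at this
  have hr0 : r 0 = 1/6 := by simp [r, PP]
  have hw0 : wt 0 = 1/3 := by simp [wt]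
  have hl0 : l 0 = -1/6 := by have := hlr 0; rw [hw0, hr0] at this; linarith
  have hsurj : ∃ c', H c' = 0 := by
    have hc : Continuous H := by
      have : LipschitzWith 2 H := LipschitzWith.of_dist_le_mul (fun x y => by
        rw [Real.dist_eq, Real.dist_eq]
        push_cast
        rcases le_total x y with h | h
        · rw [abs_sub_comm, abs_sub_comm x y, abs_of_nonneg (by linarith [(hH x y h).1]), abs_of_nonneg (by linarith)]
          exact (hH x y h).2
        · rw [abs_of_nonneg (by linarith [(hH y x h).1]), abs_of_nonneg (by linarith)]
          exact (hH y x h).2)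
      exact this.continuous
    have hle : l (-1) ≤ r (-1) := by linarith [hlr (-1), wt_pos (-1)]
    have h1 := hl (-1)
    have h2 := hr (-1)
    norm_num at h1 h2
    obtain ⟨c', -, h⟩ := intermediate_value_Icc hle hc.continuousOn (show (0:ℝ) ∈ Icc (H (l (-1))) (H (r (-1))) by
      rw [h1, h2, hl0, hr0]; constructor <;> norm_num)
    exact ⟨c', h⟩
  obtain ⟨c', hc'⟩ := hsurj
  have h1 : l (-1) + 1/12 ≤ c' ∧ c' ≤ r (-1) - 1/12 := by
    have e1 := hl (-1)
    have e2 := hr (-1)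
    norm_num at e1 e2
    have g1 : l (-1) ≤ c' := hmono.le_iff_le.1 (by rw [e1, hc', hl0]; norm_num)
    have g2 : c' ≤ r (-1) := hmono.le_iff_le.1 (by rw [e2, hc', hr0]; norm_num)
    have := (hH _ _ g1).2
    have := (hH _ _ g2).2
    constructor <;> linarith
  have h2 : l 1 + 1/12 ≤ H 0 ∧ H 0 ≤ r 1 - 1/12 := by
    have e1 := hl 0
    have e2 := hr 0
    norm_num at e1 e2
    have := (hH (l 0) 0 (by linarith)).1
    have := (hH 0 (r 0) (by linarith)).1
    constructor <;> linarith
  have d1 := hdis 1 0 0 (by simpa using hα0)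
  have d2 := hdis 0 1 1 (by simp; linarith)
  have d3 := hdis 0 (-1) 0 (by simpa using hα0)
  have d4 := hdis (-1) 0 1 (by push_cast; linarith)
  have d5 := hdis 2 0 0 (by simpa using hα0)
  have d6 := hdis 0 2 1 (by push_cast; linarith)
  push_cast at d1 d2 d3 d4 d5 d6
  have hlt2 : l 2 < r 2 := by linarith [hlr 2, wt_pos 2]
  refine ⟨H, l 2, r 2, c' + 1, hH, hH1, hap, by linarith, by linarith, by linarith, by linarith, by rw [hH1, hc']; norm_num, by linarith, hlt2, by linarith, ?_⟩
  intro x hx n j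
  have hxn : l (n + 2) ≤ H^[n] x ∧ H^[n] x ≤ r (n+2) := by
    have e1 := hHk n ((2:ℤ) * α) false
    have e2 := hHk n ((2:ℤ) * α) true
    have e1' : H^[n] (l 2) = l (n+2) := by simp only [l]; rw [e1]; congr 2; push_cast; ring
    have e2' : H^[n] (r 2) = r (n+2) := by simp only [r]; rw [e2]; congr 2; push_cast; ring
    rw [← e1', ← e2']
    exact ⟨(hmono.iterate n).monotone hx.1, (hmono.iterate n).monotone hx.2⟩
  have hsep : ∀ (m : ℤ) (y : ℝ), m < 2 → l m + 1/12 ≤ y → y ≤ r m - 1/12 → ∀ j : ℤ, 1/12 ≤ |H^[n] x - y - j| := by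
    intro m y hm hy1 hy2 j
    have hne : (m:ℝ) * α + j ≠ (n + 2 : ℤ) * α := by
      intro h
      have h2 : Irrational (((n + 2 - m : ℤ) : ℝ) * α) := hα.intCast_mul (by omega)
      apply h2
      exact ⟨j, by push_cast at h ⊢; linarith⟩
    rcases lt_or_gt_of_ne hne with h | h
    · have := hdis' _ _ _ h
      rw [abs_of_nonneg] <;> linarith [hxn.1]
    · have := hdis _ _ _ h
      rw [abs_of_nonpos] <;> linarith [hxn.2]
  refine ⟨?_, ?_, ?_⟩
  · simpa using hsep 0 0 (by norm_num) (by linarith) (by linarith) j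
  · exact hsep 1 _ (by norm_num) h2.1 h2.2 j
  · have := hsep (-1) _ (by norm_num) h1.1 h1.2 (j + 1)
    push_cast at this
    rwa [show H^[n] x - (c' + 1) - (j:ℝ) = H^[n] x - c' - (j + 1) by ring]

end Denjoy2
end
end KR

open Set Filter Topology Metric
open scoped NNReal

namespace KR
noncomputable section

section LLsec
variable {X Y Z : Type*} [PseudoEMetricSpace X] [PseudoEMetricSpace Y] [PseudoEMetricSpace Z]

def LL (f : X → Y) (x : X) : Prop := ∃ K : ℝ≥0, ∃ t ∈ 𝓝 x, LipschitzOnWith K f t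

theorem LL.of_lip {f : X → Y} {K : ℝ≥0} (h : LipschitzWith K f) (x : X) : LL f x :=
  ⟨K, univ, univ_mem, h.lipschitzOnWith⟩

theorem LL.continuousAt {f : X → Y} {x : X} (h : LL f x) : ContinuousAt f x := by
  obtain ⟨K, t, ht, h⟩ := h
  exact h.continuousOn.continuousAt ht

theorem LL.comp {g : Y → Z} {f : X → Y} {x : X} (hg : LL g (f x)) (hf : LL f x) : LL (fun x => g (f x)) x := by
  have hc := hf.continuousAt
  obtain ⟨K, t, ht, h⟩ := hf
  obtain ⟨K', t', ht', h'⟩ := hg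
  exact ⟨K' * K, t ∩ f ⁻¹' t', inter_mem ht (hc ht'), h'.comp (h.mono inter_subset_left) (fun y hy => hy.2)⟩

theorem LL.prodMk {f : X → Y} {g : X → Z} {x : X} (hf : LL f x) (hg : LL g x) : LL (fun x => (f x, g x)) x := by
  obtain ⟨K, t, ht, h⟩ := hf
  obtain ⟨K', t', ht', h'⟩ := hg
  exact ⟨max K K', t ∩ t', inter_mem ht ht', (h.mono inter_subset_left).prodMk (h'.mono inter_subset_right)⟩

theorem LL.congr {f g : X → Y} {x : X} (hf : LL f x) (h : g =ᶠ[𝓝 x] f) : LL g x := by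
  obtain ⟨K, t, ht, h1⟩ := hf
  refine ⟨K, t ∩ {y | g y = f y}, inter_mem ht h, ?_⟩
  intro a ha b hb
  rw [show g a = f a from ha.2, show g b = f b from hb.2]
  exact h1 ha.1 hb.1

theorem LL.const (c : Y) (x : X) : LL (fun _ : X => c) x := LL.of_lip (LipschitzWith.const c) x

variable {E F : Type*} [NormedAddCommGroup E] [NormedSpace ℝ E] [NormedAddCommGroup F] [NormedSpace ℝ F]

theorem LL.of_contDiffAt {f : E → F} {x : E} (h : ContDiffAt ℝ 1 f x) : LL f x := h.exists_lipschitzOnWith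

theorem LL.add {f g : X → F} {x : X} (hf : LL f x) (hg : LL g x) : LL (fun x => f x + g x) x :=
  LL.comp (g := fun p : F × F => p.1 + p.2) (LL.of_contDiffAt (by fun_prop)) (hf.prodMk hg)
theorem LL.sub {f g : X → F} {x : X} (hf : LL f x) (hg : LL g x) : LL (fun x => f x - g x) x :=
  LL.comp (g := fun p : F × F => p.1 - p.2) (LL.of_contDiffAt (by fun_prop)) (hf.prodMk hg)
theorem LL.mul {f g : X → ℝ} {x : X} (hf : LL f x) (hg : LL g x) : LL (fun x => f x * g x) x :=
  LL.comp (g := fun p : ℝ × ℝ => p.1 * p.2) (LL.of_contDiffAt (by fun_prop)) (hf.prodMk hg)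
theorem LL.smul {f : X → ℝ} {g : X → F} {x : X} (hf : LL f x) (hg : LL g x) : LL (fun x => f x • g x) x :=
  LL.comp (g := fun p : ℝ × F => p.1 • p.2) (LL.of_contDiffAt (by fun_prop)) (hf.prodMk hg)

end LLsec

/-- locally Lipschitz with bounded support in a proper space is Lipschitz -/
theorem lip_of_LL {E F : Type*} [NormedAddCommGroup E] [NormedSpace ℝ E] [ProperSpace E] [NormedAddCommGroup F]
    {g : E → F} (h : ∀ x, LL g x) (R : ℝ) (hR : 0 < R) (hs : ∀ x, R < ‖x‖ → g x = 0) :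
    ∃ K : ℝ≥0, LipschitzWith K g := by
  have hc : Continuous g := continuous_iff_continuousAt.2 (fun x => (h x).continuousAt)
  have hK := isCompact_closedBall (0:E) (2*R)
  obtain ⟨K, hKl⟩ : ∃ K, LipschitzOnWith K g (closedBall (0:E) (2*R)) := by
    refine LocallyLipschitzOn.exists_lipschitzOnWith_of_compact hK (fun x _ => ?_)
    obtain ⟨K, t, ht, h1⟩ := h x
    exact ⟨K, t, mem_nhdsWithin_of_mem_nhds ht, h1⟩
  obtain ⟨M, hM⟩ := hK.exists_bound_of_continuousOn hc.continuousOn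
  have hM0 : 0 ≤ M := (norm_nonneg _).trans (hM 0 (by simp; linarith))
  have hbd : ∀ x, ‖g x‖ ≤ M := fun x => by
    by_cases hx : ‖x‖ ≤ 2 * R
    · exact hM x (by simpa using hx)
    · rw [hs x (by linarith)]; simpa using hM0
  have key : ∀ x y, dist (g x) (g y) ≤ (K + M / R) * dist x y := by
    have key1 : ∀ x y, 2 * R < ‖y‖ → dist (g x) (g y) ≤ (K + M / R) * dist x y := by
      intro x y hy
      have h0 : 0 ≤ (K:ℝ) * dist x y := by positivity
      rw [hs y (by linarith), dist_zero_right, add_mul]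
      by_cases hx : ‖x‖ ≤ R
      · have h1 : R ≤ dist x y := by
          rw [dist_eq_norm]
          have := norm_sub_norm_le y x
          rw [norm_sub_rev] at this; linarith
        have : M ≤ M / R * dist x y := by
          calc M = M / R * R := by field_simp
            _ ≤ _ := by gcongr
        linarith [hbd x]
      · rw [hs x (by linarith)]; simp; positivity
    intro x y
    by_cases hy : 2 * R < ‖y‖
    · exact key1 x y hy
    by_cases hx : 2 * R < ‖x‖
    · rw [dist_comm, dist_comm x y]; exact key1 y x hx
    · have := hKl.dist_le_mul x (by simpa using hx) y (by simpa using hy)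
      have h2 : 0 ≤ M / R * dist x y := by positivity
      rw [add_mul]; linarith
  exact ⟨K + Real.toNNReal (M / R), LipschitzWith.of_dist_le_mul (by
    rw [NNReal.coe_add, Real.coe_toNNReal _ (by positivity)]; exact key)⟩

/-- Denjoy data -/
structure DD where
  H : ℝ → ℝ
  a : ℝ
  b : ℝ
  c : ℝ
  slope : ∀ x y, x ≤ y → (y - x)/2 ≤ H y - H x ∧ H y - H x ≤ 2 * (y - x)
  per : ∀ x, H (x+1) = H x + 1
  aper : ∀ k : ℕ, 0 < k → ∀ (j : ℤ) (x : ℝ), H^[k] x ≠ x + j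
  q0 : 0 < H 0
  q1 : H 0 < 1
  c0 : 0 < c
  c1 : c < 1
  Hc : H c = 1
  a0 : 0 < a
  ab : a < b
  b1 : b < 1
  trap : ∀ x ∈ Icc a b, ∀ (n : ℕ) (j : ℤ), 1/12 ≤ |H^[n] x - j| ∧ 1/12 ≤ |H^[n] x - H 0 - j| ∧ 1/12 ≤ |H^[n] x - c - j|

theorem exists_DD : Nonempty DD := by
  obtain ⟨H, a, b, c, h1, h2, h3, h4, h5, h6, h7, h8, h9, h10, h11, h12⟩ := denjoy
  exact ⟨⟨H, a, b, c, h1, h2, h3, h4, h5, h6, h7, h8, h9, h10, h11, h12⟩⟩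

namespace DD
variable (D : DD)

def q : ℝ := D.H 0
theorem strictMono : StrictMono D.H := fun x y hxy => by have := (D.slope x y hxy.le).1; linarith
theorem H1 : D.H 1 = D.q + 1 := by have := D.per 0; simpa [q] using this
theorem lip : LipschitzWith 2 D.H := LipschitzWith.of_dist_le_mul (fun x y => by
  rw [Real.dist_eq, Real.dist_eq]
  push_cast
  rcases le_total x y with h | h
  · rw [abs_sub_comm, abs_sub_comm x y, abs_of_nonneg (by linarith [(D.slope x y h).1]), abs_of_nonneg (by linarith)]
    exact (D.slope x y h).2
  · rw [abs_of_nonneg (by linarith [(D.slope y x h).1]), abs_of_nonneg (by linarith)]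
    exact (D.slope y x h).2)

theorem per_int (x : ℝ) (j : ℤ) : D.H (x + j) = D.H x + j := by
  induction j using Int.induction_on with
  | zero => simp
  | succ i ih => 
    push_cast at ih ⊢
    rw [← add_assoc, D.per, ih]; ring
  | pred i ih => 
    push_cast at ih ⊢
    have := D.per (x + (-i - 1))
    rw [show x + (-i-1 : ℝ) + 1 = x + -i by ring, ih] at this; linarith

theorem disp (x : ℝ) : |D.H x - x| ≤ 2 := by
  have h := D.per_int (Int.fract x) ⌊x⌋
  rw [Int.fract_add_floor] at h
  have h0 := Int.fract_nonneg x
  have h1 := Int.fract_lt_one x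
  have e := Int.fract_add_floor x
  have m0 := D.strictMono.monotone h0
  have m1 := D.strictMono.monotone h1.le
  rw [D.H1] at m1
  have := D.q0; have := D.q1
  simp only [q] at m1
  rw [abs_le]; constructor <;> linarith

def cl (t : ℝ) : ℝ := min 1 (max 0 t)
theorem cl_lip : LipschitzWith 1 cl := (LipschitzWith.id.const_max 0).const_min 1
theorem cl_nonneg (t : ℝ) : 0 ≤ cl t := le_min zero_le_one (le_max_left _ _)
theorem cl_le (t : ℝ) : cl t ≤ 1 := min_le_left _ _
theorem cl_of_nonpos {t : ℝ} (h : t ≤ 0) : cl t = 0 := by simp [cl, h]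
theorem cl_of_one_le {t : ℝ} (h : 1 ≤ t) : cl t = 1 := by rw [cl, max_eq_right (by linarith), min_eq_left h]
theorem cl_of_mem {t : ℝ} (h0 : 0 ≤ t) (h : t ≤ 1) : cl t = t := by rw [cl, max_eq_right h0, min_eq_right h]

theorem A_surj (t r : ℝ) : ∃ x, (1 - cl t) * x + cl t * D.H x = r := by
  have hc : Continuous (fun x => (1 - cl t) * x + cl t * D.H x) := by
    have := D.lip.continuous; fun_prop
  have h0 := cl_nonneg t
  have h1 := cl_le t
  have hb : ∀ x, |(1 - cl t) * x + cl t * D.H x - x| ≤ 2 := by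
    intro x
    rw [show (1 - cl t) * x + cl t * D.H x - x = cl t * (D.H x - x) by ring, abs_mul, abs_of_nonneg h0]
    have := D.disp x
    have := abs_nonneg (D.H x - x)
    nlinarith
  obtain ⟨x, -, hx⟩ := intermediate_value_Icc (show r - 2 ≤ r + 2 by linarith) hc.continuousOn (show r ∈ Icc _ _ from
    ⟨by linarith [(abs_le.1 (hb (r-2))).2], by linarith [(abs_le.1 (hb (r+2))).1]⟩)
  exact ⟨x, hx⟩

def B (t r : ℝ) : ℝ := (D.A_surj t r).choose
theorem B_spec (t r : ℝ) : (1 - cl t) * D.B t r + cl t * D.H (D.B t r) = r := (D.A_surj t r).choose_spec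

theorem A_slope {t : ℝ} (h0 : 0 ≤ t) (h1 : t ≤ 1) (x y : ℝ) : 
    |x - y| ≤ 2 * |((1 - t) * x + t * D.H x) - ((1 - t) * y + t * D.H y)| := by
  have key : ∀ x y, x ≤ y → |x - y| ≤ 2 * |((1 - t) * x + t * D.H x) - ((1 - t) * y + t * D.H y)| := by
    intro x y hxy
    have := (D.slope x y hxy).1
    have h2 : (1 - t) * y + t * D.H y - ((1 - t) * x + t * D.H x) ≥ (y - x)/2 := by nlinarith
    rw [abs_sub_comm, abs_of_nonneg (by linarith), abs_sub_comm, abs_of_nonneg (by linarith)]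
    linarith
  rcases le_total x y with h | h
  · exact key x y h
  · rw [abs_sub_comm, abs_sub_comm ((1 - t) * x + _)]; exact key y x h

theorem B_eq {t r x : ℝ} (h0 : 0 ≤ t) (h1 : t ≤ 1) (h : (1 - t) * x + t * D.H x = r) : D.B t r = x := by
  have := D.B_spec t r
  rw [cl_of_mem h0 h1] at this
  have h2 := D.A_slope h0 h1 (D.B t r) x
  rw [this, h] at h2
  simp at h2
  linarith

theorem B_lip : LipschitzWith 6 (fun p : ℝ × ℝ => D.B p.1 p.2) := by
  refine LipschitzWith.of_dist_le_mul (fun p p' => ?_)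
  obtain ⟨t, r⟩ := p
  obtain ⟨t', r'⟩ := p'
  rw [Real.dist_eq, Prod.dist_eq, Real.dist_eq, Real.dist_eq]
  have h1 := D.B_spec t r
  have h2 := D.B_spec t' r'
  have h3 := D.A_slope (cl_nonneg t) (cl_le t) (D.B t r) (D.B t' r')
  rw [h1] at h3
  have h4 := D.disp (D.B t' r')
  have h5 : |cl t - cl t'| ≤ |t - t'| := by simpa [Real.dist_eq] using cl_lip.dist_le_mul t t'
  have h6 : r - ((1 - cl t) * D.B t' r' + cl t * D.H (D.B t' r')) = (r - r') - (cl t - cl t') * (D.H (D.B t' r') - D.B t' r') := by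
    linear_combination (-1) * h2
  rw [h6] at h3
  have h7 : |(r - r') - (cl t - cl t') * (D.H (D.B t' r') - D.B t' r')| ≤ |r - r'| + |t - t'| * 2 := by
    refine (abs_sub _ _).trans ?_
    rw [abs_mul]
    gcongr
  have h8 := le_max_left |t - t'| |r - r'|
  have h9 := le_max_right |t - t'| |r - r'|
  push_cast
  show |D.B t r - D.B t' r'| ≤ _
  linarith

end DD
attribute [irreducible] DD.B
end
end KR

open Set Filter Topology Metric
open scoped NNReal

namespace KR
noncomputable section

/-! bump functions -/
def bet (θ : ℝ) : ℝ := Real.smoothTransition ((θ+1)/2)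
def bum (θ : ℝ) : ℝ := Real.smoothTransition (2*θ+3) * Real.smoothTransition (3-2*θ)
def bet1 : ℝ → ℝ := deriv bet
def bum1 : ℝ → ℝ := deriv bum
theorem bet_cd : ContDiff ℝ 2 bet := by
  unfold bet; exact (Real.smoothTransition.contDiff (n := 2)).comp (by fun_prop)
theorem bum_cd : ContDiff ℝ 2 bum := by
  unfold bum
  exact ((Real.smoothTransition.contDiff (n := 2)).comp (by fun_prop)).mul ((Real.smoothTransition.contDiff (n := 2)).comp (by fun_prop))
theorem bet1_cd : ContDiff ℝ 1 bet1 := by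
  have : ContDiff ℝ (1+1) bet := by norm_num; exact bet_cd
  exact (contDiff_succ_iff_deriv.1 this).2.2
theorem bum1_cd : ContDiff ℝ 1 bum1 := by
  have : ContDiff ℝ (1+1) bum := by norm_num; exact bum_cd
  exact (contDiff_succ_iff_deriv.1 this).2.2
theorem bet_hd (θ : ℝ) : HasDerivAt bet (bet1 θ) θ := ((bet_cd.differentiable (by norm_num)) θ).hasDerivAt
theorem bum_hd (θ : ℝ) : HasDerivAt bum (bum1 θ) θ := ((bum_cd.differentiable (by norm_num)) θ).hasDerivAt
theorem bet_nonneg (θ : ℝ) : 0 ≤ bet θ := Real.smoothTransition.nonneg _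
theorem bet_le (θ : ℝ) : bet θ ≤ 1 := Real.smoothTransition.le_one _
theorem bum_nonneg (θ : ℝ) : 0 ≤ bum θ := mul_nonneg (Real.smoothTransition.nonneg _) (Real.smoothTransition.nonneg _)
theorem bum_le (θ : ℝ) : bum θ ≤ 1 := mul_le_one₀ (Real.smoothTransition.le_one _) (Real.smoothTransition.nonneg _) (Real.smoothTransition.le_one _)
theorem bet_zero {θ : ℝ} (h : θ ≤ -1) : bet θ = 0 := Real.smoothTransition.zero_of_nonpos (by linarith)
theorem bet_one {θ : ℝ} (h : 1 ≤ θ) : bet θ = 1 := Real.smoothTransition.one_of_one_le (by linarith)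
theorem bum_one {θ : ℝ} (h : -1 ≤ θ) (h' : θ ≤ 1) : bum θ = 1 := by
  unfold bum
  rw [Real.smoothTransition.one_of_one_le (by linarith), Real.smoothTransition.one_of_one_le (by linarith)]; norm_num
theorem bum_zero {θ : ℝ} (h : 3/2 ≤ |θ|) : bum θ = 0 := by
  unfold bum
  rcases le_abs.1 h with h | h
  · rw [Real.smoothTransition.zero_of_nonpos (x := 3 - 2 * θ) (by linarith)]; simp
  · rw [Real.smoothTransition.zero_of_nonpos (x := 2 * θ + 3) (by linarith)]; simp
theorem bum1_zero {θ : ℝ} (h : 3/2 < |θ|) : bum1 θ = 0 := by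
  have : bum =ᶠ[𝓝 θ] fun _ => 0 := by
    filter_upwards [(continuous_abs.tendsto θ).eventually_const_lt h] with y hy
    exact bum_zero hy.le
  unfold bum1; rw [this.deriv_eq]; simp
theorem bet1_zero {θ : ℝ} (h : 3/2 < |θ|) : bet1 θ = 0 := by
  unfold bet1
  rcases lt_abs.1 h with h | h
  · have : bet =ᶠ[𝓝 θ] fun _ => 1 := by
      filter_upwards [lt_mem_nhds h] with y hy
      exact bet_one (by linarith)
    rw [this.deriv_eq]; simp
  · have : bet =ᶠ[𝓝 θ] fun _ => 0 := by
      filter_upwards [gt_mem_nhds (show θ < -(3/2) by linarith)] with y hy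
      exact bet_zero (by linarith)
    rw [this.deriv_eq]; simp
theorem bet1_bdd : ∃ C : ℝ≥0, ∀ θ, |bet1 θ| ≤ C := by
  obtain ⟨C, hC⟩ := (isCompact_Icc (a := (-(3/2):ℝ)) (b := 3/2)).exists_bound_of_continuousOn bet1_cd.continuous.continuousOn
  refine ⟨C.toNNReal, fun θ => ?_⟩
  by_cases h : 3/2 < |θ|
  · rw [bet1_zero h]; simp
  · push Not at h
    exact (hC θ (abs_le.1 h)).trans (Real.le_coe_toNNReal C)

def tri (y : ℝ) : ℝ := max 0 (1 - 2 * |y|)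
def uu (z : ℝ) : ℝ := tri (z + 1/2) - tri (z - 1/2)
def kk (z : ℝ) : ℝ := tri (z + 1/2) + tri (z - 1/2)
theorem tri_neg (y : ℝ) : tri (-y) = tri y := by simp [tri]
theorem tri_lip : LipschitzWith 2 tri := by
  refine LipschitzWith.of_dist_le_mul (fun x y => ?_)
  simp only [tri, Real.dist_eq]
  push_cast
  have h1 := abs_max_sub_max_le_max (0:ℝ) (1 - 2*|x|) 0 (1 - 2*|y|)
  refine h1.trans ?_
  simp only [sub_self, abs_zero]
  refine max_le (by positivity) ?_
  have := abs_abs_sub_abs_le x y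
  rw [show 1 - 2 * |x| - (1 - 2 * |y|) = -2 * (|x| - |y|) by ring, abs_mul]
  norm_num; linarith
theorem uu_neg (z : ℝ) : uu (-z) = - uu z := by
  unfold uu
  rw [show -z + 1/2 = -(z - 1/2) by ring, show -z - 1/2 = -(z + 1/2) by ring, tri_neg, tri_neg]; ring
theorem kk_neg (z : ℝ) : kk (-z) = kk z := by
  unfold kk
  rw [show -z + 1/2 = -(z - 1/2) by ring, show -z - 1/2 = -(z + 1/2) by ring, tri_neg, tri_neg]; ring
theorem tri_shift_lip (a : ℝ) : LipschitzWith 2 (fun z => tri (z + a)) := by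
  have := tri_lip.comp (LipschitzWith.of_dist_le_mul (K := 1) (f := fun z : ℝ => z + a) (by simp))
  simpa [Function.comp_def] using this
theorem uu_lip : LipschitzWith 4 uu := by
  have := (tri_shift_lip (1/2)).sub (tri_shift_lip (-(1/2)))
  unfold uu; simpa [sub_eq_add_neg, show (2:ℝ≥0) + 2 = 4 by norm_num] using this
theorem kk_lip : LipschitzWith 4 kk := by
  have := (tri_shift_lip (1/2)).add (tri_shift_lip (-(1/2)))
  unfold kk; simpa [sub_eq_add_neg, show (2:ℝ≥0) + 2 = 4 by norm_num] using this
theorem uukk_zero {z : ℝ} (h : 1 ≤ |z|) : uu z = 0 ∧ kk z = 0 := by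
  have : tri (z + 1/2) = 0 ∧ tri (z - 1/2) = 0 := by
    unfold tri
    rcases le_abs.1 h with h | h
    · constructor <;> (rw [max_eq_left]; rw [abs_of_nonneg] <;> linarith)
    · constructor <;> (rw [max_eq_left]; rw [abs_of_nonpos] <;> linarith)
  unfold uu kk; rw [this.1, this.2]; constructor <;> ring
theorem tri_cases (z : ℝ) : tri (z + 1/2) = 0 ∨ tri (z - 1/2) = 0 := by
  unfold tri
  rcases le_total z 0 with h | h
  · right; rw [max_eq_left]; rw [abs_of_nonpos] <;> linarith
  · left; rw [max_eq_left]; rw [abs_of_nonneg] <;> linarith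
theorem tri_nonneg (y : ℝ) : 0 ≤ tri y := le_max_left _ _
theorem tri_le (y : ℝ) : tri y ≤ 1 := max_le zero_le_one (by linarith [abs_nonneg y])
theorem kk_nonneg (z : ℝ) : 0 ≤ kk z := add_nonneg (tri_nonneg _) (tri_nonneg _)
theorem kk_le (z : ℝ) : kk z ≤ 1 := by
  unfold kk
  rcases tri_cases z with h | h <;> rw [h] <;> simp [tri_le]
theorem uu_abs (z : ℝ) : |uu z| ≤ 1 := by
  unfold uu
  rcases tri_cases z with h | h <;> rw [h] <;> simp [abs_of_nonneg (tri_nonneg _), tri_le]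
theorem kk_one {z : ℝ} (h : kk z = 1) : z = -(1/2) ∨ z = 1/2 := by
  have h3 : ∀ y, tri y = 1 → y = 0 := by
    intro y hy
    unfold tri at hy
    have := abs_nonneg y
    rcases max_cases 0 (1 - 2 * |y|) with h | h
    · rw [h.1] at hy; norm_num at hy
    · rw [h.1] at hy; exact abs_eq_zero.1 (by linarith)
  unfold kk at h
  rcases tri_cases z with h1 | h1
  · right; rw [h1, zero_add] at h; linarith [h3 _ h]
  · left; rw [h1, add_zero] at h; linarith [h3 _ h]
theorem uu_mhalf : uu (-(1/2)) = 1 := by simp [uu, tri]; norm_num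
theorem uu_half : uu (1/2) = -1 := by simp [uu, tri]; norm_num
/-- values on `[-1,-1/2]` -/
theorem uukk_left {z : ℝ} (h : -1 ≤ z) (h' : z ≤ -(1/2)) : uu z = 2 + 2 * z ∧ kk z = 2 + 2 * z := by
  have h1 : tri (z + 1/2) = 2 + 2 * z := by
    unfold tri; rw [max_eq_right, abs_of_nonpos] <;> [skip; linarith; skip]
    · ring
    · rw [abs_of_nonpos] <;> linarith
  have h2 : tri (z - 1/2) = 0 := by
    unfold tri; rw [max_eq_left]; rw [abs_of_nonpos] <;> linarith
  unfold uu kk; rw [h1, h2]; constructor <;> ring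

namespace DD
variable (D : DD)
def kap (x : ℝ) : ℝ := min (min (cl (12*x)) (cl (12*(1-x)))) (min (cl (12*|x-D.c|)) (cl (12*|x-D.q|)))
def kc (j : Bool) (x : ℝ) : ℝ := min (D.kap x) (cl (12*(if j then x - D.c else D.c - x)))
def kq (j : Bool) (x : ℝ) : ℝ := min (D.kap x) (cl (12*(if j then D.q - x else x - D.q)))

theorem cl_ll {X : Type*} [PseudoEMetricSpace X] {f : X → ℝ} {x : X} (h : LL f x) : LL (fun x => cl (f x)) x := (LL.of_lip cl_lip _).comp h
theorem min_ll {X : Type*} [PseudoEMetricSpace X] {f g : X → ℝ} {x : X} (h : LL f x) (h' : LL g x) : LL (fun x => min (f x) (g x)) x :=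
  LL.comp (g := fun p : ℝ × ℝ => min p.1 p.2) (LL.of_lip (LipschitzWith.prod_fst.min LipschitzWith.prod_snd) _) (h.prodMk h')
theorem abs_ll {X : Type*} [PseudoEMetricSpace X] {f : X → ℝ} {x : X} (h : LL f x) : LL (fun x => |f x|) x := 
  LL.comp (g := fun y : ℝ => |y|) (LL.of_lip lipschitzWith_one_norm _) h

theorem kap_ll (x : ℝ) : LL D.kap x := by
  unfold kap
  refine min_ll (min_ll (cl_ll ?_) (cl_ll ?_)) (min_ll (cl_ll ?_) (cl_ll ?_))
  · exact LL.of_contDiffAt (by fun_prop)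
  · exact LL.of_contDiffAt (by fun_prop)
  · exact LL.mul (LL.const _ _) (abs_ll (LL.of_contDiffAt (by fun_prop)))
  · exact LL.mul (LL.const _ _) (abs_ll (LL.of_contDiffAt (by fun_prop)))
theorem kc_ll (j : Bool) (x : ℝ) : LL (D.kc j) x := by
  unfold kc
  refine min_ll (D.kap_ll x) (cl_ll ?_)
  cases j <;> exact LL.of_contDiffAt (by simp; fun_prop)
theorem kq_ll (j : Bool) (x : ℝ) : LL (D.kq j) x := by
  unfold kq
  refine min_ll (D.kap_ll x) (cl_ll ?_)
  cases j <;> exact LL.of_contDiffAt (by simp; fun_prop)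

theorem kap_nonneg (x : ℝ) : 0 ≤ D.kap x := le_min (le_min (cl_nonneg _) (cl_nonneg _)) (le_min (cl_nonneg _) (cl_nonneg _))
theorem kap_le (x : ℝ) : D.kap x ≤ 1 := (min_le_left _ _).trans ((min_le_left _ _).trans (cl_le _))
theorem kc_nonneg (j x) : 0 ≤ D.kc j x := le_min (D.kap_nonneg _) (cl_nonneg _)
theorem kq_nonneg (j x) : 0 ≤ D.kq j x := le_min (D.kap_nonneg _) (cl_nonneg _)
theorem kap_zero {x : ℝ} (h : x ≤ 0 ∨ 1 ≤ x) : D.kap x = 0 := by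
  apply le_antisymm _ (D.kap_nonneg x)
  rcases h with h | h
  · exact (min_le_left _ _).trans ((min_le_left _ _).trans (cl_of_nonpos (by linarith)).le)
  · exact (min_le_left _ _).trans ((min_le_right _ _).trans (cl_of_nonpos (by linarith)).le)
theorem kc_true_eq {x : ℝ} (h : D.c ≤ x) : D.kc true x = D.kap x := by
  unfold kc
  rw [min_eq_left]
  refine (min_le_right _ _).trans ((min_le_left _ _).trans ?_)
  rw [abs_of_nonneg (by linarith)]; simp
theorem kc_false_eq {x : ℝ} (h : x ≤ D.c) : D.kc false x = D.kap x := by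
  unfold kc
  rw [min_eq_left]
  refine (min_le_right _ _).trans ((min_le_left _ _).trans ?_)
  rw [abs_of_nonpos (by linarith)]; simp
theorem kq_true_eq {x : ℝ} (h : x ≤ D.q) : D.kq true x = D.kap x := by
  unfold kq
  rw [min_eq_left]
  refine (min_le_right _ _).trans ((min_le_right _ _).trans ?_)
  rw [abs_of_nonpos (by linarith)]; simp
theorem kq_false_eq {x : ℝ} (h : D.q ≤ x) : D.kq false x = D.kap x := by
  unfold kq
  rw [min_eq_left]
  refine (min_le_right _ _).trans ((min_le_right _ _).trans ?_)
  rw [abs_of_nonneg (by linarith)]; simp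
theorem kc_true_zero {x : ℝ} (h : x ≤ D.c) : D.kc true x = 0 :=
  le_antisymm ((min_le_right _ _).trans (cl_of_nonpos (by simp; linarith)).le) (D.kc_nonneg _ _)
theorem kc_false_zero {x : ℝ} (h : D.c ≤ x) : D.kc false x = 0 :=
  le_antisymm ((min_le_right _ _).trans (cl_of_nonpos (by simp; linarith)).le) (D.kc_nonneg _ _)
theorem kq_true_zero {x : ℝ} (h : D.q ≤ x) : D.kq true x = 0 :=
  le_antisymm ((min_le_right _ _).trans (cl_of_nonpos (by simp; linarith)).le) (D.kq_nonneg _ _)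
theorem kq_false_zero {x : ℝ} (h : x ≤ D.q) : D.kq false x = 0 :=
  le_antisymm ((min_le_right _ _).trans (cl_of_nonpos (by simp; linarith)).le) (D.kq_nonneg _ _)
theorem kc_sum (x : ℝ) : D.kc false x + D.kc true x = D.kap x := by
  rcases le_total x D.c with h | h
  · rw [kc_false_eq _ h, kc_true_zero _ h, add_zero]
  · rw [kc_true_eq _ h, kc_false_zero _ h, zero_add]
theorem kq_sum (x : ℝ) : D.kq false x + D.kq true x = D.kap x := by
  rcases le_total x D.q with h | h
  · rw [kq_true_eq _ h, kq_false_zero _ h, zero_add]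
  · rw [kq_false_eq _ h, kq_true_zero _ h, add_zero]
theorem kap_one {x : ℝ} (h0 : 1/12 ≤ x) (h1 : x ≤ 11/12) (h2 : 1/12 ≤ |x - D.c|) (h3 : 1/12 ≤ |x - D.q|) : D.kap x = 1 := by
  unfold kap
  rw [cl_of_one_le (by linarith), cl_of_one_le (by linarith), cl_of_one_le (by linarith), cl_of_one_le (by linarith)]; simp

end DD
attribute [irreducible] bet bum bet1 bum1 uu kk DD.kap DD.kc DD.kq
end
end KR

open Set Filter Topology Metric
open scoped NNReal

namespace KR
noncomputable section

abbrev V := ℂ × ℝ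

def jr (j : Bool) : ℝ := if j then 1 else 0
@[simp] theorem jr_true : jr true = 1 := rfl
@[simp] theorem jr_false : jr false = 0 := rfl
theorem jr_cases (j : Bool) : jr j = 0 ∨ jr j = 1 := by cases j <;> simp

namespace DD
variable (D : DD)

def xl (j : Bool) (r θ : ℝ) : ℝ := D.B (bet θ) (r + jr j * bet θ)
def chi (j : Bool) (r θ : ℝ) : ℝ := (1 - bet θ) * D.kc j (D.xl j r θ) + bet θ * D.kq j (D.H (D.xl j r θ) - jr j)
def UU (j : Bool) (r θ : ℝ) : ℝ := bet1 θ * (D.H (D.xl j r θ) - jr j - D.xl j r θ)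
def ze (j : Bool) (θ z : ℝ) : ℝ := z - 4 * jr j * bum θ
def sh (j : Bool) (r θ : ℝ) (w : ℂ) (z : ℝ) : V :=
  D.chi j r θ • (uu (ze j θ z) • (((D.UU j r θ : ℂ) + Complex.I) * w, 4 * jr j * bum1 θ) - ((0 : ℂ), kk (ze j θ z)))
def g (p : V) : V := D.sh false (Complex.log p.1).re (Complex.log p.1).im p.1 p.2 + D.sh true (Complex.log p.1).re (Complex.log p.1).im p.1 p.2

theorem xl_ll (j : Bool) (p : ℝ × ℝ) : LL (fun p : ℝ × ℝ => D.xl j p.1 p.2) p := by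
  have hb : LL (fun p : ℝ × ℝ => bet p.2) p := LL.of_contDiffAt ((bet_cd.comp contDiff_snd).of_le (by norm_num)).contDiffAt
  have h1 : LL (fun p : ℝ × ℝ => p.1) p := LL.of_lip LipschitzWith.prod_fst _
  have h2 : LL (fun p : ℝ × ℝ => p.1 + jr j * bet p.2) p := LL.add h1 (LL.mul (LL.const _ _) hb)
  have h3 := LL.comp (g := fun p : ℝ × ℝ => D.B p.1 p.2) (LL.of_lip D.B_lip _) (LL.prodMk hb h2)
  exact h3
theorem Hxl_ll (j : Bool) (p : ℝ × ℝ) : LL (fun p : ℝ × ℝ => D.H (D.xl j p.1 p.2) - jr j) p :=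
  LL.sub ((LL.of_lip D.lip _).comp (D.xl_ll j p)) (LL.const _ _)
theorem chi_ll (j : Bool) (p : ℝ × ℝ) : LL (fun p : ℝ × ℝ => D.chi j p.1 p.2) p := by
  have hb : LL (fun p : ℝ × ℝ => bet p.2) p := LL.of_contDiffAt ((bet_cd.comp contDiff_snd).of_le (by norm_num)).contDiffAt
  exact LL.add (LL.mul (LL.sub (LL.const _ _) hb) ((D.kc_ll j _).comp (D.xl_ll j p))) (LL.mul hb ((D.kq_ll j _).comp (D.Hxl_ll j p)))
theorem UU_ll (j : Bool) (p : ℝ × ℝ) : LL (fun p : ℝ × ℝ => D.UU j p.1 p.2) p := by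
  have hb : LL (fun p : ℝ × ℝ => bet1 p.2) p := LL.of_contDiffAt (bet1_cd.comp contDiff_snd).contDiffAt
  exact LL.mul hb (LL.sub (D.Hxl_ll j p) (D.xl_ll j p))

theorem sh_ll (j : Bool) (p : V) (hp : p.1 ∈ Complex.slitPlane) :
    LL (fun p : V => D.sh j (Complex.log p.1).re (Complex.log p.1).im p.1 p.2) p := by
  have hl : ContDiffAt ℝ 1 (fun p : V => Complex.log p.1) p :=
    ((Complex.contDiffAt_log hp).restrict_scalars ℝ).comp p contDiffAt_fst
  have hre : LL (fun p : V => (Complex.log p.1).re) p := LL.of_contDiffAt (Complex.reCLM.contDiff.contDiffAt.comp p hl)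
  have him : LL (fun p : V => (Complex.log p.1).im) p := LL.of_contDiffAt (Complex.imCLM.contDiff.contDiffAt.comp p hl)
  have hrt := hre.prodMk him
  have hchi := LL.comp (g := fun p : ℝ × ℝ => D.chi j p.1 p.2) (D.chi_ll j _) hrt
  have hU := LL.comp (g := fun p : ℝ × ℝ => D.UU j p.1 p.2) (D.UU_ll j _) hrt
  have hbum : LL (fun p : V => bum (Complex.log p.1).im) p :=
    LL.comp (g := bum) (LL.of_contDiffAt (bum_cd.of_le (by norm_num)).contDiffAt) him
  have hbum1 : LL (fun p : V => bum1 (Complex.log p.1).im) p :=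
    LL.comp (g := bum1) (LL.of_contDiffAt bum1_cd.contDiffAt) him
  have hz : LL (fun p : V => ze j (Complex.log p.1).im p.2) p := by
    unfold ze
    have h1 : LL (fun p : V => p.2) p := LL.of_lip LipschitzWith.prod_snd _
    exact LL.sub h1 (LL.mul (LL.const _ _) hbum)
  have hf : LL (fun p : V => p.1) p := LL.of_lip LipschitzWith.prod_fst _
  have hw : LL (fun p : V => ((D.UU j (Complex.log p.1).re (Complex.log p.1).im : ℂ) + Complex.I) * p.1) p := by
    have h0 : ContDiff ℝ 1 (fun q : ℝ × ℂ => (q.1 : ℂ)) := Complex.ofRealCLM.contDiff.comp contDiff_fst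
    have h1 : ContDiff ℝ 1 (fun q : ℝ × ℂ => ((q.1 : ℂ) + Complex.I) * q.2) := (h0.add contDiff_const).mul contDiff_snd
    have h2 := LL.comp (g := fun q : ℝ × ℂ => ((q.1 : ℂ) + Complex.I) * q.2) (LL.of_contDiffAt h1.contDiffAt) (hU.prodMk hf)
    exact h2
  have hu := (LL.of_lip uu_lip _).comp hz
  have hk := (LL.of_lip kk_lip _).comp hz
  have h4 := LL.mul (LL.const (4 * jr j) p) hbum1
  have h5 := LL.smul hu (hw.prodMk h4)
  have h6 := LL.sub h5 ((LL.const (0:ℂ) p).prodMk hk)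
  exact LL.smul hchi h6

theorem xl_spec (j : Bool) (r θ : ℝ) : (1 - bet θ) * D.xl j r θ + bet θ * (D.H (D.xl j r θ) - jr j) = r := by
  have := D.B_spec (bet θ) (r + jr j * bet θ)
  rw [cl_of_mem (bet_nonneg θ) (bet_le θ)] at this
  unfold xl; linarith
theorem xl_eq {j : Bool} {r θ x : ℝ} (h : (1 - bet θ) * x + bet θ * (D.H x - jr j) = r) : D.xl j r θ = x :=
  D.B_eq (bet_nonneg θ) (bet_le θ) (by linarith)

theorem kap_pos {x : ℝ} (h : 0 < D.kap x) : 0 < x ∧ x < 1 := by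
  by_contra hn
  rw [D.kap_zero (by by_contra h2; push Not at h2; exact hn h2)] at h; exact lt_irrefl _ h
theorem kc_pos {j : Bool} {x : ℝ} (h : 0 < D.kc j x) : (0 < x ∧ x < 1) ∧ (if j then D.c < x else x < D.c) := by
  refine ⟨D.kap_pos (h.trans_le (by unfold kc; exact min_le_left _ _)), ?_⟩
  by_contra hn
  cases j
  · rw [D.kc_false_zero (by simpa using hn)] at h; exact lt_irrefl _ h
  · rw [D.kc_true_zero (by simpa using hn)] at h; exact lt_irrefl _ h
theorem kq_pos {j : Bool} {x : ℝ} (h : 0 < D.kq j x) : (0 < x ∧ x < 1) ∧ (if j then x < D.q else D.q < x) := by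
  refine ⟨D.kap_pos (h.trans_le (by unfold kq; exact min_le_left _ _)), ?_⟩
  by_contra hn
  cases j
  · rw [D.kq_false_zero (by simpa using hn)] at h; exact lt_irrefl _ h
  · rw [D.kq_true_zero (by simpa using hn)] at h; exact lt_irrefl _ h

/-- position facts -/
def Pos (j : Bool) (x : ℝ) : Prop := 0 < x ∧ x < 1 ∧ 0 < D.H x - jr j ∧ D.H x - jr j < 1 ∧
  (if j then D.c < x ∧ D.H x - jr j < D.q else x < D.c ∧ D.q < D.H x - jr j)

theorem pos_of_c {j : Bool} {x : ℝ} (h : (0 < x ∧ x < 1) ∧ (if j then D.c < x else x < D.c)) : D.Pos j x := by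
  obtain ⟨⟨h0, h1⟩, h2⟩ := h
  have q0 : 0 < D.q := D.q0
  have q1 : D.q < 1 := D.q1
  have a0 : D.q < D.H x := D.strictMono h0
  have a1 := D.strictMono h1
  rw [D.H1] at a1
  cases j
  · simp only [Bool.false_eq_true, if_false] at h2
    have := D.strictMono h2
    rw [D.Hc] at this
    simp [Pos, *]; linarith
  · simp only [if_true] at h2
    have := D.strictMono h2
    rw [D.Hc] at this
    simp [Pos, *]; constructor <;> linarith
theorem pos_of_q {j : Bool} {x : ℝ} (h : (0 < D.H x - jr j ∧ D.H x - jr j < 1) ∧ (if j then D.H x - jr j < D.q else D.q < D.H x - jr j)) : D.Pos j x := by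
  obtain ⟨⟨h0, h1⟩, h2⟩ := h
  have c0 := D.c0
  have c1 := D.c1
  apply D.pos_of_c
  cases j
  · simp at h0 h1 h2 ⊢
    have a0 : 0 < x := D.strictMono.lt_iff_lt.1 h2
    have a1 : x < D.c := D.strictMono.lt_iff_lt.1 (by rw [D.Hc]; exact h1)
    refine ⟨⟨a0, by linarith⟩, a1⟩
  · simp at h0 h1 h2 ⊢
    have a0 : D.c < x := D.strictMono.lt_iff_lt.1 (by rw [D.Hc]; linarith)
    have a1 : x < 1 := D.strictMono.lt_iff_lt.1 (by rw [D.H1]; linarith)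
    refine ⟨⟨by linarith, by linarith⟩, a0⟩

theorem chi_nonneg (j r θ) : 0 ≤ D.chi j r θ := by
  have := bet_nonneg θ; have h := bet_le θ
  have := D.kc_nonneg j (D.xl j r θ); have := D.kq_nonneg j (D.H (D.xl j r θ) - jr j)
  have h2 : 0 ≤ 1 - bet θ := by linarith
  unfold chi; positivity
theorem chi_pos {j : Bool} {r θ : ℝ} (h : 0 < D.chi j r θ) : D.Pos j (D.xl j r θ) := by
  by_cases h1 : 0 < D.kc j (D.xl j r θ)
  · exact D.pos_of_c (D.kc_pos h1)
  by_cases h2 : 0 < D.kq j (D.H (D.xl j r θ) - jr j)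
  · exact D.pos_of_q (D.kq_pos h2)
  have e1 := le_antisymm (not_lt.1 h1) (D.kc_nonneg _ _)
  have e2 := le_antisymm (not_lt.1 h2) (D.kq_nonneg _ _)
  unfold chi at h; rw [e1, e2] at h; simp at h

theorem chi_pos_r {j : Bool} {r θ : ℝ} (h : 0 < D.chi j r θ) : 0 < r ∧ r < 1 := by
  obtain ⟨h1, h2, h3, h4, -⟩ := D.chi_pos h
  have := (convex_Ioo (0:ℝ) 1) ⟨h1, h2⟩ ⟨h3, h4⟩ (sub_nonneg.2 (bet_le θ)) (bet_nonneg θ) (by ring)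
  simp only [smul_eq_mul] at this
  rwa [D.xl_spec j r θ] at this

def core0 : Set V := {p | ∃ j, 0 < D.chi j (Complex.log p.1).re (Complex.log p.1).im ∧ |ze j (Complex.log p.1).im p.2| < 1}

theorem sh_zero {j : Bool} {r θ : ℝ} {w : ℂ} {z : ℝ} (h : ¬ (0 < D.chi j r θ ∧ |ze j θ z| < 1)) : D.sh j r θ w z = 0 := by
  unfold sh
  by_cases h1 : 0 < D.chi j r θ
  · have := uukk_zero (z := ze j θ z) (by by_contra h2; exact h ⟨h1, not_le.1 h2⟩)
    rw [this.1, this.2]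
    ext <;> simp
  · rw [le_antisymm (not_lt.1 h1) (D.chi_nonneg _ _ _), zero_smul]

theorem g_zero {p : V} (h : p ∉ D.core0) : D.g p = 0 := by
  have : ∀ j, ¬ _ := fun j hj => h ⟨j, hj⟩
  unfold g
  rw [D.sh_zero (this false), D.sh_zero (this true), add_zero]

theorem ze_bd {j : Bool} {θ z : ℝ} (h : |ze j θ z| < 1) : |z| < 5 := by
  have h1 := bum_nonneg θ; have h2 := bum_le θ
  unfold ze at h
  rw [abs_lt] at h ⊢
  rcases jr_cases j with e | e <;> rw [e] at h <;> constructor <;> linarith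

theorem core0_bd {p : V} (h : p ∈ D.core0) : 1 < ‖p.1‖ ∧ ‖p.1‖ < 3 ∧ |p.2| < 5 := by
  obtain ⟨j, h1, h2⟩ := h
  have h3 := D.chi_pos_r h1
  rw [Complex.log_re] at h3
  have hp : 0 < ‖p.1‖ := by
    by_contra hn
    have := le_antisymm (not_lt.1 hn) (norm_nonneg _)
    rw [this] at h3; simp at h3
  refine ⟨?_, ?_, ze_bd h2⟩
  · exact (Real.log_pos_iff hp.le).1 h3.1
  · have := (Real.log_lt_iff_lt_exp hp).1 h3.2
    linarith [Real.exp_one_lt_d9]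

theorem g_left {p : V} (h : p.1.re < 0) : D.g p = D.kap (Real.log ‖p.1‖) • (uu p.2 • (Complex.I * p.1, 0) - ((0 : ℂ), kk p.2)) := by
  have harg : 3/2 < |(Complex.log p.1).im| := by
    rw [Complex.log_im]
    have h1 : ¬ |p.1.arg| ≤ Real.pi / 2 := by
      rw [Complex.abs_arg_le_pi_div_two_iff]; exact not_le.2 h
    push Not at h1
    linarith [Real.pi_gt_three]
  rw [← Complex.log_re]
  unfold g sh UU ze
  generalize (Complex.log p.1).im = θ at *
  generalize (Complex.log p.1).re = r at *
  rw [bet1_zero harg, bum1_zero harg, bum_zero harg.le]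
  simp only [zero_mul, mul_zero, Complex.ofReal_zero, zero_add, sub_zero]
  rw [← add_smul]
  congr 1
  unfold chi
  rcases lt_abs.1 harg with h1 | h1
  · have hb := bet_one (θ := θ) (by linarith)
    have s1 := D.xl_spec false r θ
    have s2 := D.xl_spec true r θ
    rw [hb] at s1 s2 ⊢
    simp only [sub_self, zero_mul, zero_add, one_mul] at s1 s2 ⊢
    rw [s1, s2, D.kq_sum]
  · have hb := bet_zero (θ := θ) (by linarith)
    have s1 := D.xl_spec false r θ
    have s2 := D.xl_spec true r θ
    rw [hb] at s1 s2 ⊢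
    simp only [sub_zero, zero_mul, add_zero, one_mul] at s1 s2 ⊢
    rw [s1, s2, D.kc_sum]

theorem g_ll (p : V) : LL D.g p := by
  by_cases h0 : p.1 = 0
  · refine (LL.const (0:V) p).congr ?_
    have : ∀ᶠ p' : V in 𝓝 p, ‖p'.1‖ < 1 :=
      (continuous_fst.norm.tendsto p).eventually_lt_const (by simp [h0])
    filter_upwards [this] with p' hp'
    exact D.g_zero (fun hc => by linarith [(D.core0_bd hc).1])
  by_cases h : p.1 ∈ Complex.slitPlane
  · exact LL.add (D.sh_ll false p h) (D.sh_ll true p h)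
  have hre : p.1.re < 0 := by
    rw [Complex.mem_slitPlane_iff] at h
    push Not at h
    rcases h.1.lt_or_eq with h1 | h1
    · exact h1
    · exact absurd (Complex.ext h1 h.2) h0
  have hc : LL (fun p : V => D.kap (Real.log ‖p.1‖) • (uu p.2 • (Complex.I * p.1, (0:ℝ)) - ((0 : ℂ), kk p.2))) p := by
    have hlog : LL (fun p : V => Real.log ‖p.1‖) p := by
      refine LL.of_contDiffAt (ContDiffAt.log ?_ (by simpa using h0))
      exact (contDiffAt_fst.norm ℝ h0)
    have h2 : LL (fun p : V => p.2) p := LL.of_contDiffAt contDiffAt_snd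
    refine LL.smul ((D.kap_ll _).comp hlog) (LL.sub (LL.smul ((LL.of_lip uu_lip _).comp h2) ((LL.of_contDiffAt ?_).prodMk (LL.const _ _))) ((LL.const _ _).prodMk ((LL.of_lip kk_lip _).comp h2)))
    exact (contDiffAt_const.mul contDiffAt_fst)
  refine hc.congr ?_
  have : ∀ᶠ p' : V in 𝓝 p, p'.1.re < 0 :=
      ((Complex.continuous_re.comp continuous_fst).tendsto p).eventually_lt_const hre
  filter_upwards [this] with p' hp'
  exact D.g_left hp'

theorem g_lip : ∃ K : ℝ≥0, LipschitzWith K D.g := by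
  refine lip_of_LL D.g_ll 5 (by norm_num) (fun x hx => D.g_zero (fun hc => ?_))
  obtain ⟨h1, h2, h3⟩ := D.core0_bd hc
  have : ‖x‖ ≤ 5 := max_le (by linarith) (by rw [Real.norm_eq_abs]; linarith)
  linarith
theorem g_bdd : ∃ M : ℝ≥0, ∀ p, ‖D.g p‖ ≤ M := by
  obtain ⟨K, hK⟩ := D.g_lip
  have h00 : D.g ((0:ℂ), (6:ℝ)) = 0 := D.g_zero (fun hc => by have := (D.core0_bd hc).2.2; norm_num [abs_of_nonneg] at this)
  refine ⟨K * 11, fun p => ?_⟩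
  by_cases hc : p ∈ D.core0
  · have := hK.dist_le_mul p ((0:ℂ), (6:ℝ))
    rw [h00, dist_zero_right] at this
    refine this.trans ?_
    push_cast
    gcongr
    obtain ⟨h1, h2, h3⟩ := D.core0_bd hc
    rw [abs_lt] at h3
    rw [Prod.dist_eq]
    refine max_le ?_ ?_
    · rw [dist_zero_right]; linarith
    · rw [Real.dist_eq, abs_le]; constructor <;> linarith
  · rw [D.g_zero hc]; simp

end DD
end
end KR

open Set Filter Topology Metric
open scoped NNReal

namespace KR
noncomputable section


def kp (s : ℝ) : ℤ := ⌈(s - Real.pi) / (2 * Real.pi)⌉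
def th (s : ℝ) : ℝ := s - 2 * Real.pi * kp s

theorem th_mem (s : ℝ) : -Real.pi < th s ∧ th s ≤ Real.pi := by
  have hp := Real.pi_pos
  have h1 := Int.le_ceil ((s - Real.pi) / (2 * Real.pi))
  have h2 := Int.ceil_lt_add_one ((s - Real.pi) / (2 * Real.pi))
  rw [div_le_iff₀ (by positivity)] at h1
  have e : (s - Real.pi) / (2 * Real.pi) + 1 = (s + Real.pi) / (2 * Real.pi) := by field_simp; ring
  rw [e, lt_div_iff₀ (by positivity)] at h2
  unfold th kp
  constructor <;> linarith

theorem kp_eq {s : ℝ} {k : ℤ} (h1 : -Real.pi < s - 2 * Real.pi * k) (h2 : s - 2 * Real.pi * k ≤ Real.pi) : kp s = k := by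
  have hp := Real.pi_pos
  unfold kp
  rw [Int.ceil_eq_iff]
  constructor
  · rw [lt_div_iff₀ (by positivity)]; linarith
  · rw [div_le_iff₀ (by positivity)]; linarith

theorem glue_eq {f : ℤ → ℝ → ℝ} (hf : ∀ k θ, 3/2 < θ → θ < 2 * Real.pi - 3/2 → f k θ = f (k+1) (θ - 2 * Real.pi))
    {s : ℝ} {k : ℤ} (hs : |s - 2 * Real.pi * k| < 2 * Real.pi - 3/2) : f (kp s) (th s) = f k (s - 2 * Real.pi * k) := by
  have hp := Real.pi_gt_three
  rw [abs_lt] at hs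
  unfold th
  by_cases h1 : s - 2 * Real.pi * k ≤ -Real.pi
  · have : kp s = k - 1 := kp_eq (by push_cast; linarith) (by push_cast; linarith)
    rw [this, hf _ _ (by push_cast; linarith) (by push_cast; linarith)]
    push_cast
    congr 1 <;> ring
  by_cases h2 : s - 2 * Real.pi * k ≤ Real.pi
  · rw [kp_eq (not_le.1 h1) h2]
  · have : kp s = k + 1 := kp_eq (by push_cast; linarith) (by push_cast; linarith)
    rw [this, hf k _ (by linarith) (by linarith)]
    push_cast
    congr 1; ring

theorem glue_hd {f f' : ℤ → ℝ → ℝ} (hf : ∀ k θ, 3/2 < θ → θ < 2 * Real.pi - 3/2 → f k θ = f (k+1) (θ - 2 * Real.pi))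
    (hd : ∀ k θ, HasDerivAt (f k) (f' k θ) θ) (s : ℝ) :
    HasDerivAt (fun s => f (kp s) (th s)) (f' (kp s) (th s)) s := by
  have hp := Real.pi_gt_three
  have h0 : HasDerivAt (fun y => y - 2 * Real.pi * kp s) 1 s := (hasDerivAt_id s).sub_const (2 * Real.pi * kp s)
  have h1 := HasDerivAt.comp s (h₂ := f (kp s)) (h := fun y => y - 2 * Real.pi * kp s) (hd (kp s) (th s)) h0
  rw [mul_one] at h1
  refine h1.congr_of_eventuallyEq ?_
  have h2 := th_mem s
  unfold th at h2
  have : ∀ᶠ y in 𝓝 s, |y - 2 * Real.pi * kp s| < 2 * Real.pi - 3/2 := by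
    refine ((continuous_abs.comp (continuous_sub_right (2 * Real.pi * kp s))).tendsto s).eventually_lt_const ?_
    simp only [Function.comp]
    rw [abs_lt]; constructor <;> linarith
  filter_upwards [this] with y hy
  exact glue_eq hf hy

def lin (y : ℤ → ℝ) (s : ℝ) : ℝ := y (kp s) + bet (th s) * (y (kp s + 1) - y (kp s))
def lin1 (y : ℤ → ℝ) (s : ℝ) : ℝ := bet1 (th s) * (y (kp s + 1) - y (kp s))
def bmp (y : ℤ → ℝ) (s : ℝ) : ℝ := 4 * y (kp s) * bum (th s)
def bmp1 (y : ℤ → ℝ) (s : ℝ) : ℝ := 4 * y (kp s) * bum1 (th s)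

theorem lin_hd (y : ℤ → ℝ) (s : ℝ) : HasDerivAt (lin y) (lin1 y s) s := by
  refine glue_hd (f := fun k θ => y k + bet θ * (y (k+1) - y k)) (f' := fun k θ => bet1 θ * (y (k+1) - y k)) ?_ ?_ s
  · intro k θ h1 h2
    rw [bet_one (by linarith), bet_zero (by linarith)]; ring
  · intro k θ
    exact ((bet_hd θ).mul_const _).const_add _
theorem bmp_hd (y : ℤ → ℝ) (s : ℝ) : HasDerivAt (bmp y) (bmp1 y s) s := by
  refine glue_hd (f := fun k θ => 4 * y k * bum θ) (f' := fun k θ => 4 * y k * bum1 θ) ?_ ?_ s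
  · intro k θ h1 h2
    rw [bum_zero (by rw [abs_of_nonneg] <;> linarith), bum_zero (by rw [abs_of_nonpos] <;> linarith)]; ring
  · intro k θ
    exact (bum_hd θ).const_mul _

theorem lin_lip (y : ℤ → ℝ) (h0 : ∀ k, 0 ≤ y k) (h1 : ∀ k, y k ≤ 1) : ∃ C : ℝ≥0, LipschitzWith C (lin y) := by
  obtain ⟨C, hC⟩ := bet1_bdd
  refine ⟨C, lipschitzWith_of_nnnorm_deriv_le (fun s => (lin_hd y s).differentiableAt) (fun s => ?_)⟩
  rw [(lin_hd y s).deriv, ← NNReal.coe_le_coe, coe_nnnorm, Real.norm_eq_abs]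
  unfold lin1
  rw [abs_mul]
  have := hC (th s)
  have h2 : |y (kp s + 1) - y (kp s)| ≤ 1 := by
    rw [abs_le]; constructor <;> linarith [h0 (kp s), h1 (kp s), h0 (kp s + 1), h1 (kp s + 1)]
  calc _ ≤ (C:ℝ) * 1 := by gcongr
    _ = C := by ring
theorem lin_mem (y : ℤ → ℝ) {a b : ℝ} (s : ℝ) (h0 : ∀ k, kp s ≤ k → a ≤ y k) (h1 : ∀ k, kp s ≤ k → y k ≤ b) : a ≤ lin y s ∧ lin y s ≤ b := by
  have e : lin y s = (1 - bet (th s)) * y (kp s) + bet (th s) * y (kp s + 1) := by unfold lin; ring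
  rw [e]
  have b0 := bet_nonneg (th s)
  have b1 := bet_le (th s)
  have := h0 (kp s) le_rfl; have := h1 (kp s) le_rfl
  have := h0 (kp s + 1) (by linarith); have := h1 (kp s + 1) (by linarith)
  constructor <;> nlinarith

structure Orb (D : DD) where
  x : ℤ → ℝ
  j : ℤ → Bool
  x0 : ∀ k, 0 ≤ x k
  x1 : ∀ k, x k < 1
  hs : ∀ k, x (k+1) = D.H (x k) - jr (j k)

namespace Orb
variable {D : DD} (o : Orb D)

theorem j_true {k : ℤ} (h : o.j k = true) : D.c ≤ o.x k ∧ o.x (k+1) < D.q := by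
  have h1 := o.hs k
  have h2 := o.x0 (k+1)
  rw [h, jr_true] at h1
  constructor
  · rw [← D.strictMono.le_iff_le, D.Hc]; linarith
  · have := D.strictMono (o.x1 k); rw [D.H1] at this; linarith
theorem j_false {k : ℤ} (h : o.j k = false) : o.x k < D.c ∧ D.q ≤ o.x (k+1) := by
  have h1 := o.hs k
  have h2 := o.x1 (k+1)
  rw [h, jr_false] at h1
  constructor
  · rw [← D.strictMono.lt_iff_lt, D.Hc]; linarith
  · have : D.H 0 ≤ _ := D.strictMono.monotone (o.x0 k); unfold DD.q; linarith
theorem kc_own (k : ℤ) : D.kc (o.j k) (o.x k) = D.kap (o.x k) := by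
  cases h : o.j k
  · exact D.kc_false_eq (o.j_false h).1.le
  · exact D.kc_true_eq (o.j_true h).1
theorem kq_own (k : ℤ) : D.kq (o.j k) (o.x (k+1)) = D.kap (o.x (k+1)) := by
  cases h : o.j k
  · exact D.kq_false_eq (o.j_false h).2
  · exact D.kq_true_eq (o.j_true h).2.le
theorem kc_other (k : ℤ) : D.kc (!o.j k) (o.x k) = 0 := by
  cases h : o.j k
  · exact D.kc_true_zero (o.j_false h).1.le
  · exact D.kc_false_zero (o.j_true h).1
theorem kq_other (k : ℤ) : D.kq (!o.j k) (o.x (k+1)) = 0 := by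
  cases h : o.j k
  · exact D.kq_true_zero (o.j_false h).2
  · exact D.kq_false_zero (o.j_true h).2.le

theorem iter (k : ℤ) (m : ℕ) : ∃ i : ℤ, o.x (k + m) = D.H^[m] (o.x k) + i := by
  induction m with
  | zero => exact ⟨0, by simp⟩
  | succ m ih =>
    obtain ⟨i, hi⟩ := ih
    rw [Function.iterate_succ_apply']
    have h1 := o.hs (k + m)
    rw [hi, D.per_int] at h1
    push_cast
    rw [← add_assoc, h1]
    cases o.j (k + m)
    · exact ⟨i, by simp⟩
    · exact ⟨i - 1, by push_cast; simp; ring⟩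
theorem aper_nat (k : ℤ) (m : ℕ) (hm : 0 < m) : o.x (k + m) ≠ o.x k := by
  obtain ⟨i, hi⟩ := o.iter k m
  intro h
  refine D.aper m hm (-i) (o.x k) ?_
  push_cast; linarith
theorem aper (k m : ℤ) (hm : m ≠ 0) : o.x (k + m) ≠ o.x k := by
  rcases lt_or_gt_of_ne hm with h | h
  · obtain ⟨n, rfl⟩ := Int.exists_eq_neg_ofNat h.le
    intro he
    refine o.aper_nat (k + -n) n (by omega) ?_
    rw [he]; congr 1; ring
  · obtain ⟨n, rfl⟩ := Int.eq_ofNat_of_zero_le h.le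
    exact o.aper_nat k n (by omega)

theorem kap_trap (h : o.x 0 ∈ Icc D.a D.b) {k : ℤ} (hk : 0 ≤ k) : D.kap (o.x k) = 1 := by
  obtain ⟨n, rfl⟩ := Int.eq_ofNat_of_zero_le hk
  obtain ⟨i, hi⟩ := o.iter 0 n
  rw [zero_add] at hi
  have h0 := o.x0 n; have h1 := o.x1 n
  have a1 := (D.trap _ h n (-i)).1
  have a2 := (D.trap _ h n (1-i)).1
  have a3 := (D.trap _ h n (-i)).2.1
  have a4 := (D.trap _ h n (-i)).2.2
  rw [show D.H^[n] (o.x 0) = o.x n - i by linarith] at a1 a2 a3 a4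
  push_cast at a1 a2 a3 a4
  rw [show o.x n - i - -(i:ℝ) = o.x n by ring, abs_of_nonneg h0] at a1
  rw [show o.x n - i - (1-(i:ℝ)) = o.x n - 1 by ring, abs_of_nonpos (by linarith)] at a2
  rw [show o.x n - i - D.H 0 - -(i:ℝ) = o.x n - D.q by unfold DD.q; ring] at a3
  rw [show o.x n - i - D.c - -(i:ℝ) = o.x n - D.c by ring] at a4
  exact D.kap_one a1 (by linarith) a4 a3

theorem ex (D : DD) (x : ℝ) (h0 : 0 ≤ x) (h1 : x < 1) : ∃ o : Orb D, o.x 0 = x := by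
  have hsurj : Function.Surjective D.H := by
    intro r
    obtain ⟨x, hx⟩ := D.A_surj 1 r
    rw [DD.cl_of_one_le le_rfl] at hx
    exact ⟨x, by linarith⟩
  let He : Equiv.Perm ℝ := Equiv.ofBijective D.H ⟨D.strictMono.injective, hsurj⟩
  have hHe : ∀ y, He y = D.H y := fun y => rfl
  let y : ℤ → ℝ := fun k => Int.fract ((He ^ k) x)
  refine ⟨⟨y, fun k => decide (1 ≤ D.H (y k)), fun k => Int.fract_nonneg _, fun k => Int.fract_lt_one _, fun k => ?_⟩, ?_⟩
  · have e1 : (He ^ (k+1)) x = D.H ((He ^ k) x) := by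
      rw [add_comm, zpow_one_add, Equiv.Perm.mul_apply, hHe]
    have e2 : D.H ((He ^ k) x) = D.H (y k) + (⌊(He ^ k) x⌋ : ℤ) := by
      rw [← D.per_int]; simp only [y]; rw [Int.fract_add_floor]
    have e3 : y (k+1) = Int.fract (D.H (y k)) := by
      show Int.fract ((He ^ (k+1)) x) = _
      rw [e1, e2, Int.fract_add_intCast]
    rw [e3]
    have g0 : D.H 0 ≤ D.H (y k) := D.strictMono.monotone (Int.fract_nonneg _)
    have g1 : D.H (y k) < D.H 1 := D.strictMono (Int.fract_lt_one _)
    rw [D.H1] at g1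
    have := D.q0
    have hq1 : D.q < 1 := D.q1
    by_cases h : 1 ≤ D.H (y k)
    · simp only [h, decide_true, jr_true]
      rw [Int.fract_eq_iff]
      refine ⟨by linarith, by linarith, 1, by push_cast; ring⟩
    · simp only [h, decide_false, jr_false]
      push Not at h
      rw [sub_zero, Int.fract_eq_self]
      exact ⟨by linarith, h⟩
  · show Int.fract ((He ^ (0:ℤ)) x) = x
    rw [zpow_zero]; exact Int.fract_eq_self.2 ⟨h0, h1⟩

def R (s : ℝ) : ℝ := lin o.x s
def R1 (s : ℝ) : ℝ := lin1 o.x s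
def N (s : ℝ) : ℝ := bmp (fun k => jr (o.j k)) s
def N1 (s : ℝ) : ℝ := bmp1 (fun k => jr (o.j k)) s
def X (s : ℝ) : ℝ := lin (fun k => D.kap (o.x k)) s
def W (s : ℝ) : ℂ := Complex.exp ((o.R s : ℂ) + s * Complex.I)
def E (s ζ : ℝ) : V := (o.W s, o.N s + ζ)

theorem X_nonneg (s) : 0 ≤ o.X s := (lin_mem (a := 0) (b := 1) _ s (fun _ _ => D.kap_nonneg _) (fun _ _ => D.kap_le _)).1
theorem X_le (s) : o.X s ≤ 1 := (lin_mem (a := 0) (b := 1) _ s (fun _ _ => D.kap_nonneg _) (fun _ _ => D.kap_le _)).2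
theorem X_lip : ∃ C : ℝ≥0, LipschitzWith C o.X := lin_lip _ (fun _ => D.kap_nonneg _) (fun _ => D.kap_le _)
theorem X_trap (h : o.x 0 ∈ Icc D.a D.b) {s : ℝ} (hs : -Real.pi < s) : o.X s = 1 := by
  refine le_antisymm (o.X_le s) ?_
  refine (lin_mem (a := 1) (b := 1) _ s (fun k hk => ?_) (fun k hk => D.kap_le _)).1
  refine (o.kap_trap h (le_trans ?_ hk)).ge
  by_contra hn
  have hn : kp s ≤ -1 := by omega
  have := (th_mem s).2
  unfold th at this
  have h3 : (kp s : ℝ) ≤ -1 := by exact_mod_cast hn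
  have := Real.pi_pos
  nlinarith

theorem W_log (s : ℝ) : Complex.log (o.W s) = (o.R s : ℂ) + th s * Complex.I := by
  have h := th_mem s
  have : o.W s = Complex.exp ((o.R s : ℂ) + th s * Complex.I) := by
    unfold W
    rw [Complex.exp_eq_exp_iff_exists_int]
    refine ⟨kp s, ?_⟩
    unfold th; push_cast; ring
  rw [this, Complex.log_exp] <;> simp <;> linarith

theorem xl_own (s : ℝ) : D.xl (o.j (kp s)) (o.R s) (th s) = o.x (kp s) := by
  apply D.xl_eq
  rw [← o.hs]; unfold R lin; ring
theorem chi_own (s : ℝ) : D.chi (o.j (kp s)) (o.R s) (th s) = o.X s := by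
  unfold DD.chi; rw [o.xl_own, ← o.hs, o.kc_own, o.kq_own]; unfold X lin; ring
theorem ze_own (s ζ : ℝ) : DD.ze (o.j (kp s)) (th s) (o.N s + ζ) = ζ := by
  unfold DD.ze N bmp; ring
theorem UU_own (s : ℝ) : D.UU (o.j (kp s)) (o.R s) (th s) = o.R1 s := by
  unfold DD.UU; rw [o.xl_own, ← o.hs]; rfl

theorem other (s ζ : ℝ) (hζ : |ζ| ≤ 1) : ¬ (0 < D.chi (!o.j (kp s)) (o.R s) (th s) ∧ |DD.ze (!o.j (kp s)) (th s) (o.N s + ζ)| < 1) := by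
  rintro ⟨h1, h2⟩
  by_cases c1 : th s ≤ -1
  · have hb := bet_zero c1
    have hx : D.xl (!o.j (kp s)) (o.R s) (th s) = o.x (kp s) := by
      apply D.xl_eq; unfold R lin; rw [hb]; ring
    unfold DD.chi at h1
    rw [hb, hx, o.kc_other] at h1; simp at h1
  by_cases c2 : 1 ≤ th s
  · have hb := bet_one c2
    have hx := D.xl_spec (!o.j (kp s)) (o.R s) (th s)
    unfold DD.chi at h1
    rw [hb] at h1 hx
    simp only [sub_self, zero_mul, one_mul, zero_add] at h1 hx
    rw [hx] at h1
    have : o.R s = o.x (kp s + 1) := by unfold R lin; rw [hb]; ring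
    rw [this, o.kq_other] at h1; simp at h1
  · have hb := bum_one (θ := th s) (by linarith) (by linarith)
    unfold DD.ze N bmp at h2
    rw [hb] at h2
    rw [abs_lt] at h2; rw [abs_le] at hζ
    cases h : o.j (kp s) <;> simp [h] at h2 <;> linarith

theorem g_E (s ζ : ℝ) (hζ : |ζ| ≤ 1) : D.g (o.E s ζ) =
    o.X s • (uu ζ • (((o.R1 s : ℂ) + Complex.I) * o.W s, o.N1 s) - ((0:ℂ), kk ζ)) := by
  have hsh : D.sh (o.j (kp s)) (o.R s) (th s) (o.W s) (o.N s + ζ) = 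
      o.X s • (uu ζ • (((o.R1 s : ℂ) + Complex.I) * o.W s, o.N1 s) - ((0:ℂ), kk ζ)) := by
    unfold DD.sh
    rw [o.chi_own, o.ze_own, o.UU_own]; rfl
  have hsh' := D.sh_zero (w := o.W s) (o.other s ζ hζ)
  have hre : (Complex.log (o.W s)).re = o.R s := by rw [o.W_log]; simp
  have him : (Complex.log (o.W s)).im = th s := by rw [o.W_log]; simp
  unfold DD.g E
  simp only
  rw [hre, him]
  cases h : o.j (kp s)
  · rw [h] at hsh hsh'
    simp only [Bool.not_false] at hsh'
    rw [hsh, hsh', add_zero]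
  · rw [h] at hsh hsh'
    simp only [Bool.not_true] at hsh'
    rw [hsh, hsh', zero_add]

theorem E_core {s ζ : ℝ} (hζ : |ζ| ≤ 1) : o.E s ζ ∈ D.core0 ↔ 0 < o.X s ∧ |ζ| < 1 := by
  have hre : (Complex.log (o.W s)).re = o.R s := by rw [o.W_log]; simp
  have him : (Complex.log (o.W s)).im = th s := by rw [o.W_log]; simp
  unfold DD.core0 E
  simp only [mem_ofPred_eq]
  rw [hre, him]
  constructor
  · rintro ⟨j, hj⟩
    by_cases hjj : j = o.j (kp s)
    · subst hjj
      rwa [o.chi_own, o.ze_own] at hj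
    · have : j = !o.j (kp s) := by
        revert hjj; cases j <;> cases o.j (kp s) <;> simp
      subst this
      exact absurd hj (o.other s ζ hζ)
  · intro h
    refine ⟨o.j (kp s), ?_⟩
    rwa [o.chi_own, o.ze_own]

theorem kp_zero {θ : ℝ} (h1 : -Real.pi < θ) (h2 : θ ≤ Real.pi) : kp θ = 0 ∧ th θ = θ := by
  have : kp θ = 0 := kp_eq (by simpa using h1) (by simpa using h2)
  refine ⟨this, ?_⟩
  unfold th; rw [this]; simp

theorem core_ex {p : V} (h : p ∈ D.core0) : ∃ (o : Orb D) (s ζ : ℝ), p = o.E s ζ ∧ 0 < o.X s ∧ |ζ| < 1 := by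
  have hbd := D.core0_bd h
  obtain ⟨j, h1, h2⟩ := h
  have hP := D.chi_pos h1
  obtain ⟨o, ho⟩ := ex D _ hP.1.le hP.2.1
  have hj : o.j 0 = j := by
    have hP2 := hP.2.2.2.2
    rw [← ho] at hP2
    cases j <;> cases h : o.j 0 <;> simp at hP2 ⊢
    · linarith [(o.j_true h).1, hP2.1]
    · linarith [(o.j_false h).1, hP2.1]
  set θ := (Complex.log p.1).im with hθ
  have hk := kp_zero (θ := θ) (by rw [hθ]; exact Complex.neg_pi_lt_log_im _) (by rw [hθ]; exact Complex.log_im_le_pi _)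
  have hR : o.R θ = (Complex.log p.1).re := by
    unfold R lin
    rw [hk.1, hk.2, zero_add]
    have h3 := o.hs 0
    rw [zero_add] at h3
    rw [h3, hj, ho]
    have := D.xl_spec j (Complex.log p.1).re θ
    linarith
  have hE : p = o.E θ (DD.ze j θ p.2) := by
    unfold E
    ext1
    · simp only [W]
      rw [hR, hθ, Complex.re_add_im, Complex.exp_log]
      intro h0; rw [h0] at hbd; norm_num at hbd
    · simp only [N, bmp, DD.ze]
      rw [hk.1, hk.2, hj]; ring
  refine ⟨o, θ, DD.ze j θ p.2, hE, ?_, h2⟩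
  rw [← o.chi_own, hk.1, hk.2, hj, hR]; exact h1

theorem W_hd (s : ℝ) : HasDerivAt o.W (((o.R1 s : ℂ) + Complex.I) * o.W s) s := by
  have h1 : HasDerivAt (fun s : ℝ => (o.R s : ℂ) + s * Complex.I) ((o.R1 s : ℂ) + Complex.I) s := by
    have := ((lin_hd o.x s).ofReal_comp).add (((hasDerivAt_id s).ofReal_comp).mul_const Complex.I)
    simp only [Complex.ofReal_one, one_mul] at this
    exact this
  have := h1.cexp
  rw [mul_comm]; exact this
theorem N_hd (s : ℝ) : HasDerivAt o.N (o.N1 s) s := bmp_hd (fun k => jr (o.j k)) s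

end Orb
end
end KR

open Set Filter Topology Metric
open scoped NNReal

namespace KR
noncomputable section

theorem mul_lip {f h : ℝ → ℝ} {C1 C2 : ℝ≥0} (hf : LipschitzWith C1 f) (hh : LipschitzWith C2 h) (bf : ∀ x, |f x| ≤ 1) (bh : ∀ x, |h x| ≤ 1) :
    LipschitzWith (C1 + C2) (fun p : ℝ × ℝ => f p.1 * h p.2) := by
  refine LipschitzWith.of_dist_le_mul (fun p p' => ?_)
  rw [Real.dist_eq]
  have h1 := hf.dist_le_mul p.1 p'.1
  have h2 := hh.dist_le_mul p.2 p'.2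
  have d1 : dist p.1 p'.1 ≤ dist p p' := by rw [Prod.dist_eq]; exact le_max_left _ _
  have d2 : dist p.2 p'.2 ≤ dist p p' := by rw [Prod.dist_eq]; exact le_max_right _ _
  rw [Real.dist_eq] at h1 h2
  have e : f p.1 * h p.2 - f p'.1 * h p'.2 = (f p.1 - f p'.1) * h p.2 + f p'.1 * (h p.2 - h p'.2) := by ring
  rw [e]
  refine (abs_add_le _ _).trans ?_
  rw [abs_mul, abs_mul]
  push_cast
  calc _ ≤ |f p.1 - f p'.1| * 1 + 1 * |h p.2 - h p'.2| := by gcongr <;> [exact bh _; exact bf _]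
    _ ≤ C1 * dist p p' + C2 * dist p p' := by
      rw [mul_one, one_mul]
      refine add_le_add (h1.trans (by gcongr)) (h2.trans (by gcongr))
    _ = _ := by ring

namespace Orb
variable {D : DD} (o : Orb D)

def pf (p : ℝ × ℝ) : ℝ × ℝ := (o.X p.1 * uu p.2, 1 - o.X p.1 * kk p.2)

theorem pf_flow : ∃ ψ : ℝ → ℝ × ℝ → ℝ × ℝ, IsFlowOf o.pf ψ := by
  obtain ⟨C, hC⟩ := o.X_lip
  have bX : ∀ s, |o.X s| ≤ 1 := fun s => by rw [abs_of_nonneg (o.X_nonneg s)]; exact o.X_le s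
  have bk : ∀ s, |kk s| ≤ 1 := fun s => by rw [abs_of_nonneg (kk_nonneg s)]; exact kk_le s
  have h1 := mul_lip hC uu_lip bX uu_abs
  have h2 := mul_lip hC kk_lip bX bk
  have h3 : LipschitzWith (0 + (C + 4)) (fun p : ℝ × ℝ => 1 - o.X p.1 * kk p.2) := (LipschitzWith.const (1:ℝ)).sub h2
  refine exists_flow (v := o.pf) (h1.prodMk h3) (M := 2) (fun p => ?_)
  unfold pf
  have m1 := bX p.1; have m2 := bk p.2; have m3 := uu_abs p.2
  have a1 : |o.X p.1 * uu p.2| ≤ 1 := by rw [abs_mul]; exact mul_le_one₀ m1 (abs_nonneg _) m3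
  have a2 : |o.X p.1 * kk p.2| ≤ 1 := by rw [abs_mul]; exact mul_le_one₀ m1 (abs_nonneg _) m2
  refine max_le ?_ ?_
  · rw [Real.norm_eq_abs]; push_cast; linarith
  · rw [Real.norm_eq_abs]; push_cast; rw [abs_le] at a2 ⊢; constructor <;> linarith

/-- a solution of the planar system -/
structure Sol (S Z : ℝ → ℝ) : Prop where
  dS : ∀ t, HasDerivAt S (o.X (S t) * uu (Z t)) t
  dZ : ∀ t, HasDerivAt Z (1 - o.X (S t) * kk (Z t)) t

theorem sol_ex (s ζ : ℝ) : ∃ S Z, o.Sol S Z ∧ S 0 = s ∧ Z 0 = ζ := by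
  obtain ⟨ψ, hψ⟩ := o.pf_flow
  refine ⟨fun t => (ψ t (s, ζ)).1, fun t => (ψ t (s, ζ)).2, ⟨fun t => ?_, fun t => ?_⟩, ?_, ?_⟩
  · exact (hψ.deriv t (s, ζ)).fst
  · exact (hψ.deriv t (s, ζ)).snd
  · simp [hψ.zero]
  · simp [hψ.zero]

theorem Sol.uniq {S Z S' Z' : ℝ → ℝ} (h : o.Sol S Z) {a b t0 t : ℝ} 
    (dS : ∀ t ∈ Icc a b, HasDerivAt S' (o.X (S' t) * uu (Z' t)) t) 
    (dZ : ∀ t ∈ Icc a b, HasDerivAt Z' (1 - o.X (S' t) * kk (Z' t)) t)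
    (ht0 : t0 ∈ Icc a b) (ht : t ∈ Icc a b) (e1 : S' t0 = S t0) (e2 : Z' t0 = Z t0) : S' t = S t ∧ Z' t = Z t := by
  obtain ⟨ψ, hψ⟩ := o.pf_flow
  have h1 := hψ.eq_of_forall (γ := fun t => (S t, Z t)) (fun t _ => (h.dS t).prodMk (h.dZ t)) ht0 ht
  have h2 := hψ.eq_of_forall (γ := fun t => (S' t, Z' t)) (fun t ht => (dS t ht).prodMk (dZ t ht)) ht0 ht
  rw [e1, e2, ← h1] at h2
  exact Prod.mk.inj h2

theorem Sol.mono {S Z : ℝ → ℝ} (h : o.Sol S Z) : Monotone Z := by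
  refine monotone_of_deriv_nonneg (fun t => (h.dZ t).differentiableAt) (fun t => ?_)
  rw [(h.dZ t).deriv]
  have := mul_le_one₀ (o.X_le (S t)) (kk_nonneg (Z t)) (kk_le (Z t))
  linarith

theorem Sol.refl {S Z : ℝ → ℝ} (h : o.Sol S Z) : o.Sol (fun t => S (-t)) (fun t => - Z (-t)) := by
  constructor
  · intro t
    have := (h.dS (-t)).scomp t (hasDerivAt_neg t)
    simp only [smul_eq_mul, Function.comp_def] at this
    rw [uu_neg]; exact this.congr_deriv (by ring)
  · intro t
    have := ((h.dZ (-t)).scomp t (hasDerivAt_neg t)).neg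
    simp only [smul_eq_mul, Function.comp_def] at this
    rw [kk_neg]; exact this.congr_deriv (by ring)
theorem Sol.shift {S Z : ℝ → ℝ} (h : o.Sol S Z) (c : ℝ) : o.Sol (fun t => S (t + c)) (fun t => Z (t + c)) :=
  ⟨fun t => (h.dS (t + c)).comp_add_const t c, fun t => (h.dZ (t + c)).comp_add_const t c⟩

theorem Sol.sym {S Z : ℝ → ℝ} (h : o.Sol S Z) {t0 : ℝ} (h0 : Z t0 = 0) : S (2 * t0) = S 0 ∧ Z (2 * t0) = - Z 0 := by
  have h1 := (h.shift o (2*t0)).refl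
  have h2 := h.uniq o (S' := fun t => S (-t + 2*t0)) (Z' := fun t => - Z (-t + 2*t0)) (a := -|2 * t0|) (b := |2 * t0|) (t0 := t0) (t := 0)
    (fun t _ => h1.dS t) (fun t _ => h1.dZ t) (abs_le.1 (by rw [abs_mul]; norm_num; linarith [abs_nonneg t0])) (by simp)
    (by congr 1; ring) (by rw [show -t0 + 2 * t0 = t0 by ring, h0]; simp)
  simp only [neg_zero, zero_add] at h2
  exact ⟨h2.1, by linarith [h2.2]⟩

theorem N_mem (s : ℝ) : 0 ≤ o.N s ∧ o.N s ≤ 4 := by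
  unfold N bmp
  have := bum_nonneg (th s); have := bum_le (th s)
  rcases jr_cases (o.j (kp s)) with h | h <;> simp only [h] <;> constructor <;> linarith
theorem W_norm (s : ℝ) : ‖o.W s‖ < 3 := by
  unfold W
  rw [Complex.norm_exp]
  simp
  have : o.R s ≤ 1 := (lin_mem (a := 0) (b := 1) o.x s (fun k _ => o.x0 k) (fun k _ => (o.x1 k).le)).2
  calc _ ≤ Real.exp 1 := Real.exp_le_exp.2 this
    _ < 3 := by linarith [Real.exp_one_lt_d9]
end Orb

/-- in the closed sheet neighbourhood, offset by `A` -/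
def InE (D : DD) (A p : V) : Prop := ∃ (o : Orb D) (s ζ : ℝ), |ζ| ≤ 1 ∧ p = A + o.E s ζ

theorem InE.bd {D : DD} {A p : V} (h : InE D A p) : ‖p.1 - A.1‖ < 3 ∧ |p.2 - A.2| ≤ 5 := by
  obtain ⟨o, s, ζ, h1, rfl⟩ := h
  have h2 := o.N_mem s
  rw [abs_le] at h1
  refine ⟨by simpa [Orb.E] using o.W_norm s, ?_⟩
  simp only [Orb.E, Prod.snd_add, add_sub_cancel_left]
  rw [abs_le]; constructor <;> linarith

/-- the flow looks like the model field around `A` -/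
structure Mod (D : DD) (v : V → V) (φ : ℝ → V → V) (A : V) : Prop where
  fl : IsFlowOf v φ
  md : ∀ p : V, ‖p.1‖ < 3 → |p.2| ≤ 5 → v (A + p) = (0, 1) + D.g p

namespace Mod
variable {D : DD} {v : V → V} {φ : ℝ → V → V} {A : V}

theorem curve (M : Mod D v φ A) (o : Orb D) {S Z : ℝ → ℝ} (h : o.Sol S Z) {a b s t : ℝ} (hZ : ∀ t ∈ Icc a b, |Z t| ≤ 1) (hs : s ∈ Icc a b) (ht : t ∈ Icc a b) :
    φ (t - s) (A + o.E (S s) (Z s)) = A + o.E (S t) (Z t) := by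
  refine (M.fl.eq_of_forall (γ := fun t => A + o.E (S t) (Z t)) (fun t ht => ?_) hs ht).symm
  have hz := hZ t ht
  have h2 := o.N_mem (S t)
  have hz' := abs_le.1 hz
  rw [M.md _ (o.W_norm (S t)) (abs_le.2 ⟨by simp only [Orb.E]; linarith, by simp only [Orb.E]; linarith⟩), o.g_E _ _ hz]
  have d1 := (o.W_hd (S t)).scomp t (h.dS t)
  have d2 := ((o.N_hd (S t)).comp t (h.dS t)).add (h.dZ t)
  have d3 := (d1.prodMk d2).const_add A
  refine HasDerivAt.congr_deriv d3 ?_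
  ext1
  · simp [mul_smul]
  · simp; ring

end Mod
end
end KR

open Set Filter Topology Metric
open scoped NNReal

namespace KR
noncomputable section

namespace Orb
variable {D : DD} (o : Orb D)

theorem W_inj {s s' : ℝ} (h : o.W s = o.W s') : o.R s = o.R s' ∧ th s = th s' := by
  have h1 := o.W_log s
  rw [h, o.W_log s'] at h1
  have h2 := congrArg Complex.re h1
  have h3 := congrArg Complex.im h1
  simp at h2 h3
  exact ⟨h2.symm, h3.symm⟩

theorem E_inj {s s' ζ ζ' : ℝ} (h : o.E s ζ = o.E s' ζ') (hX : 0 < o.X s) (hζ : |ζ| < 1) (hζ' : |ζ'| ≤ 1) : ζ = ζ' := by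
  have h1 : o.W s = o.W s' := congrArg Prod.fst h
  have h2 : o.N s + ζ = o.N s' + ζ' := congrArg Prod.snd h
  obtain ⟨e1, e2⟩ := o.W_inj h1
  have e3 : o.j (kp s) = o.j (kp s') := by
    by_contra hne
    refine o.other s' ζ' hζ' ?_
    have : (!o.j (kp s')) = o.j (kp s) := by
      revert hne; cases o.j (kp s) <;> cases o.j (kp s') <;> simp
    rw [this, ← e1, ← e2, ← h2, o.ze_own, o.chi_own]
    exact ⟨hX, hζ⟩
  have e4 : o.N s = o.N s' := by
    show 4 * jr (o.j (kp s)) * bum (th s) = 4 * jr (o.j (kp s')) * bum (th s')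
    rw [e3, e2]
  linarith

theorem no_shift {s s' : ℝ} {k : ℤ} (hs : s = -2 + 2 * Real.pi * k) (hne : s ≠ s') (h : o.W s = o.W s') : False := by
  have hp := Real.pi_gt_three
  have hk : kp s = k := kp_eq (by rw [hs]; linarith) (by rw [hs]; linarith)
  obtain ⟨h1, h2⟩ := o.W_inj h
  have ht : th s = -2 := by unfold th; rw [hk, hs]; ring
  have hb : bet (th s) = 0 := bet_zero (by rw [ht]; norm_num)
  unfold R lin at h1
  rw [← h2, hb] at h1
  simp only [zero_mul, add_zero] at h1
  have hm : kp s' ≠ kp s := by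
    intro he
    unfold th at h2; rw [he] at h2
    exact hne (by linarith)
  refine o.aper (kp s) (kp s' - kp s) (by omega) ?_
  rw [h1]; congr 1; ring

/-- trapped solutions lie in the core -/
theorem Sol.core {S Z : ℝ → ℝ} (h : o.Sol S Z) (hZ : ∀ t, 0 ≤ t → |Z t| ≤ 1) {t : ℝ} (ht : 0 < t) : 0 < o.X (S t) ∧ |Z t| < 1 := by
  constructor
  · by_contra hn
    have h0 := le_antisymm (not_lt.1 hn) (o.X_nonneg _)
    have := h.uniq o (S' := fun _ => S t) (Z' := fun y => Z t + (y - t)) (a := t) (b := t + 3) (t0 := t) (t := t + 3)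
      (fun y _ => by rw [h0, zero_mul]; exact hasDerivAt_const _ _)
      (fun y _ => by rw [h0, zero_mul, sub_zero]; exact ((hasDerivAt_id y).sub_const t).const_add _) (by simp) (by simp) rfl (by simp)
    have h1 := abs_le.1 (hZ t ht.le)
    have h2 := abs_le.1 (hZ (t+3) (by linarith))
    linarith [this.2]
  · by_contra hn
    have h1 : |Z t| = 1 := le_antisymm (hZ t ht.le) (not_lt.1 hn)
    have hd := h.dZ t
    rw [(uukk_zero h1.ge).2, mul_zero, sub_zero] at hd
    have hev : ∀ᶠ y in 𝓝 t, |Z y| ≤ 1 := by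
      filter_upwards [lt_mem_nhds ht] with y hy
      exact hZ y (le_of_lt hy)
    rcases (abs_eq zero_le_one).1 h1 with e | e
    · have : IsLocalMax Z t := by
        filter_upwards [hev] with y hy
        rw [e]; exact (abs_le.1 hy).2
      have := this.hasDerivAt_eq_zero hd
      norm_num at this
    · have : IsLocalMin Z t := by
        filter_upwards [hev] with y hy
        rw [e]; exact (abs_le.1 hy).1
      have := this.hasDerivAt_eq_zero hd
      norm_num at this

theorem Sol.aper {S Z : ℝ → ℝ} (h : o.Sol S Z) (hZ : ∀ t, 0 ≤ t → |Z t| ≤ 1) {T : ℝ} (hT : 0 < T)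
    (hp : ∀ t, 0 ≤ t → o.E (S (t + T)) (Z (t + T)) = o.E (S t) (Z t)) : False := by
  have hpi := Real.pi_gt_three
  have zp : ∀ t, 0 < t → Z (t + T) = Z t := by
    intro t ht
    have h1 := h.core o hZ (t := t + T) (by linarith)
    exact o.E_inj (hp t ht.le) h1.1 h1.2 (hZ t ht.le)
  have zn : ∀ n : ℕ, Z (1/2 + n * T) = Z (1/2) := by
    intro n
    induction n with
    | zero => simp
    | succ n ih =>
      rw [← ih, ← zp (1/2 + n*T) (by positivity)]
      congr 1; push_cast; ring
  have zc : ∀ t, 1/2 ≤ t → Z t = Z (1/2) := by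
    intro t ht
    obtain ⟨n, hn⟩ := exists_nat_ge (t / T)
    rw [div_le_iff₀ hT] at hn
    refine le_antisymm ?_ (h.mono o ht)
    rw [← zn n]; exact h.mono o (by linarith)
  have hk : ∀ t, 1/2 < t → o.X (S t) = 1 ∧ kk (Z (1/2)) = 1 := by
    intro t ht
    have hd := h.dZ t
    have hc : HasDerivAt Z 0 t := by
      refine (hasDerivAt_const t (Z (1/2))).congr_of_eventuallyEq ?_
      filter_upwards [lt_mem_nhds ht] with y hy
      exact zc y (le_of_lt hy)
    have e := hd.unique hc
    rw [zc t ht.le] at e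
    have a1 := o.X_le (S t); have a2 := o.X_nonneg (S t); have a3 := kk_le (Z (1/2)); have a4 := kk_nonneg (Z (1/2))
    constructor <;> nlinarith
  obtain ⟨σ, hσ, hu⟩ : ∃ σ : ℝ, (σ = 1 ∨ σ = -1) ∧ uu (Z (1/2)) = σ := by
    rcases kk_one (hk 1 (by norm_num)).2 with e | e
    · exact ⟨1, Or.inl rfl, by rw [e, uu_mhalf]⟩
    · exact ⟨-1, Or.inr rfl, by rw [e, uu_half]⟩
  have sc : ∀ t, 1 ≤ t → S t = S 1 + σ * (t - 1) := by
    intro t ht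
    have := (h.uniq o (S' := fun t => S 1 + σ * (t - 1)) (Z' := Z) (a := 1) (b := t) (t0 := 1) (t := t))
    -- derivative of S is σ
    have hdS : ∀ y ∈ Ico 1 t, HasDerivWithinAt S σ (Ici y) y := by
      intro y hy
      have := h.dS y
      rw [(hk y (by linarith [hy.1])).1, zc y (by linarith [hy.1]), hu, one_mul] at this
      exact this.hasDerivWithinAt
    have hdL : ∀ y ∈ Ico 1 t, HasDerivWithinAt (fun t => S 1 + σ * (t - 1)) σ (Ici y) y := by
      intro y hy
      have := (((hasDerivAt_id y).sub_const 1).const_mul σ).const_add (S 1)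
      rw [mul_one] at this
      exact this.hasDerivWithinAt
    exact eq_of_has_deriv_right_eq (f' := fun _ => σ) hdS hdL (fun y _ => (h.dS y).continuousAt.continuousWithinAt) (by fun_prop) (by simp) t ⟨ht, le_rfl⟩
  obtain ⟨t, k, ht, hk2⟩ : ∃ (t : ℝ) (k : ℤ), 1 ≤ t ∧ S t = -2 + 2 * Real.pi * k := by
    obtain ⟨n, hn⟩ := exists_nat_ge (|S 1| + 2)
    have := neg_abs_le (S 1); have := le_abs_self (S 1)
    have hn2 : (n:ℝ) ≤ 2 * Real.pi * n := by nlinarith [Nat.cast_nonneg (α := ℝ) n]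
    rcases hσ with e | e
    · refine ⟨1 + (-2 + 2 * Real.pi * n - S 1), n, by linarith, ?_⟩
      rw [sc _ (by linarith), e]; push_cast; ring
    · refine ⟨1 - (-2 - 2 * Real.pi * n - S 1), -n, by linarith, ?_⟩
      rw [sc _ (by linarith), e]; push_cast; ring
  refine o.no_shift hk2 (s' := S (t + T)) ?_ (congrArg Prod.fst (hp t (by linarith))).symm
  rw [sc t ht, sc (t+T) (by linarith)]
  intro he
  have : σ * T = 0 := by linarith
  rcases hσ with e | e <;> rw [e] at this <;> linarith

theorem Sol.trap (h0 : o.x 0 ∈ Icc D.a D.b) {S Z : ℝ → ℝ} (h : o.Sol S Z) (hS : -Real.pi < S 0) (hZ : Z 0 = -1) (t : ℝ) (ht : 0 ≤ t) : Z t < 0 := by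
  have hd : ∀ t, HasDerivAt (fun t : ℝ => Real.exp (-2 * t)) (-2 * Real.exp (-2 * t)) t := by
    intro t
    have := ((hasDerivAt_id t).const_mul (-2)).exp
    refine this.congr_deriv ?_
    simp; ring
  have key : ∀ y ∈ Icc 0 t, o.X (S 0 + y - (1 - Real.exp (-2 * y))/2) = 1 ∧ uu (-(1/2) - Real.exp (-2*y)/2) = 1 - Real.exp (-2*y) ∧ kk (-(1/2) - Real.exp (-2*y)/2) = 1 - Real.exp (-2*y) := by
    intro y hy
    have e1 := Real.add_one_le_exp (-2 * y)
    have e2 := Real.exp_pos (-2 * y)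
    have e3 : Real.exp (-2 * y) ≤ 1 := Real.exp_le_one_iff.2 (by linarith [hy.1])
    refine ⟨o.X_trap h0 (by linarith), ?_, ?_⟩
    · rw [(uukk_left (by linarith) (by linarith)).1]; ring
    · rw [(uukk_left (by linarith) (by linarith)).2]; ring
  have := h.uniq o (S' := fun y => S 0 + y - (1 - Real.exp (-2 * y))/2) (Z' := fun y => -(1/2) - Real.exp (-2*y)/2) (a := 0) (b := t) (t0 := 0) (t := t)
    (fun y hy => by
      obtain ⟨k1, k2, k3⟩ := key y hy
      rw [k1, k2, one_mul]
      have := ((hasDerivAt_id y).const_add (S 0)).sub (((hd y).const_sub 1).div_const 2)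
      refine this.congr_deriv (by ring))
    (fun y hy => by
      obtain ⟨k1, k2, k3⟩ := key y hy
      rw [k1, k3, one_mul]
      have := ((hd y).div_const 2).const_sub (-(1/2))
      refine this.congr_deriv (by ring)) ⟨le_rfl, ht⟩ ⟨ht, le_rfl⟩ (by simp) (by simp [hZ]; norm_num)
  rw [← this.2]
  have := Real.exp_pos (-2 * t)
  linarith

end Orb

namespace Mod
variable {D : DD} {v : V → V} {φ : ℝ → V → V} {A : V}

/-- trap alternative at the foot `E s (-1)` -/
def CaseB (D : DD) (φ : ℝ → V → V) (A : V) (p p' : V) : Prop :=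
  (∀ t, 0 ≤ t → InE D A (φ t p)) ∧ (∀ t, 0 ≤ t → InE D A (φ (-t) p')) ∧ (∀ T, 0 < T → φ T p ≠ p)

theorem nonper (M : Mod D v φ A) (o : Orb D) {S Z : ℝ → ℝ} (h : o.Sol S Z) (hZ : ∀ t, 0 ≤ t → |Z t| ≤ 1) {T : ℝ} (hT : 0 < T) : 
    φ T (A + o.E (S 0) (Z 0)) ≠ A + o.E (S 0) (Z 0) := by
  intro hp
  refine h.aper o hZ hT (fun t ht => ?_)
  have h1 := M.curve o h (a := 0) (b := t + T) (s := 0) (t := t) (fun y hy => hZ y hy.1) ⟨le_rfl, by linarith⟩ ⟨ht, by linarith⟩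
  have h2 := M.curve o h (a := 0) (b := t + T) (s := 0) (t := t + T) (fun y hy => hZ y hy.1) ⟨le_rfl, by linarith⟩ ⟨by linarith, by linarith⟩
  rw [sub_zero] at h1 h2
  rw [M.fl.add, hp, h1] at h2
  exact (add_left_cancel h2).symm

theorem caseB (M : Mod D v φ A) (o : Orb D) {S Z : ℝ → ℝ} (h : o.Sol S Z) (h0 : Z 0 = -1) (hZ : ∀ t, 0 ≤ t → Z t < 0) :
    CaseB D φ A (A + o.E (S 0) (-1)) (A + o.E (S 0) 1) := by
  have hZ1 : ∀ t, 0 ≤ t → |Z t| ≤ 1 := fun t ht => by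
    have := h.mono o ht
    rw [abs_le]; constructor <;> linarith [hZ t ht]
  refine ⟨fun t ht => ?_, fun t ht => ?_, fun T hT => ?_⟩
  · have h1 := M.curve o h (a := 0) (b := t) (s := 0) (t := t) (fun y hy => hZ1 y hy.1) ⟨le_rfl, ht⟩ ⟨ht, le_rfl⟩
    rw [sub_zero, h0] at h1
    rw [h1]
    exact ⟨o, _, _, hZ1 t ht, rfl⟩
  · have h1 := M.curve o (h.refl o) (a := -t) (b := 0) (s := 0) (t := -t) (fun y hy => by rw [abs_neg]; exact hZ1 (-y) (by linarith [hy.2])) ⟨by linarith, le_rfl⟩ ⟨le_rfl, by linarith⟩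
    simp only [neg_zero, sub_zero, h0, neg_neg] at h1
    rw [h1]
    exact ⟨o, _, _, by rw [abs_neg]; exact hZ1 t ht, rfl⟩
  · have := M.nonper o h hZ1 hT
    rwa [h0] at this

theorem cases (M : Mod D v φ A) (o : Orb D) (s : ℝ) :
    (∃ T, 0 ≤ T ∧ φ T (A + o.E s (-1)) = A + o.E s 1 ∧ ∀ t ∈ Icc 0 T, InE D A (φ t (A + o.E s (-1)))) ∨
    CaseB D φ A (A + o.E s (-1)) (A + o.E s 1) := by
  obtain ⟨S, Z, h, rfl, h0⟩ := o.sol_ex s (-1)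
  by_cases hB : ∀ t, 0 ≤ t → Z t < 0
  · exact Or.inr (M.caseB o h h0 hB)
  left
  push Not at hB
  obtain ⟨t, ht, hZt⟩ := hB
  have hc : Continuous Z := continuous_iff_continuousAt.2 (fun t => (h.dZ t).continuousAt)
  obtain ⟨t0, ht0, hz⟩ := intermediate_value_Icc ht hc.continuousOn (show (0:ℝ) ∈ Icc _ _ from ⟨by linarith, hZt⟩)
  obtain ⟨e1, e2⟩ := h.sym o hz
  rw [h0, neg_neg] at e2
  have h00 := ht0.1
  have hZ1 : ∀ y ∈ Icc 0 (2 * t0), |Z y| ≤ 1 := fun y hy => by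
    have a1 := h.mono o hy.1; have a2 := h.mono o hy.2
    rw [abs_le]; constructor <;> linarith
  have hcv : ∀ t ∈ Icc 0 (2 * t0), φ t (A + o.E (S 0) (-1)) = A + o.E (S t) (Z t) := by
    intro t ht
    have := M.curve o h (a := 0) (b := 2 * t0) (s := 0) (t := t) hZ1 ⟨le_rfl, by linarith⟩ ht
    rwa [sub_zero, h0] at this
  refine ⟨2 * t0, by linarith, ?_, fun t ht => ?_⟩
  · rw [hcv _ ⟨by linarith, le_rfl⟩, e1, e2]
  · rw [hcv t ht]; exact ⟨o, _, _, hZ1 t ht, rfl⟩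

theorem trap (M : Mod D v φ A) (o : Orb D) (h0 : o.x 0 ∈ Icc D.a D.b) (s : ℝ) (hs : -Real.pi < s) :
    CaseB D φ A (A + o.E s (-1)) (A + o.E s 1) := by
  obtain ⟨S, Z, h, rfl, hz⟩ := o.sol_ex s (-1)
  exact M.caseB o h hz (h.trap o h0 hs hz)

theorem core_fwd (M : Mod D v φ A) (o : Orb D) (s ζ : ℝ) (hζ : |ζ| < 1) :
    ((∀ t, 0 ≤ t → InE D A (φ t (A + o.E s ζ))) ∧ ∀ T, 0 < T → φ T (A + o.E s ζ) ≠ A + o.E s ζ) ∨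
    ∃ T, 0 ≤ T ∧ (∀ t ∈ Icc 0 T, InE D A (φ t (A + o.E s ζ))) ∧ ∃ s', φ T (A + o.E s ζ) = A + o.E s' 1 := by
  obtain ⟨S, Z, h, rfl, rfl⟩ := o.sol_ex s ζ
  have hz0 := abs_lt.1 hζ
  by_cases hB : ∀ t, 0 ≤ t → Z t < 1
  · left
    have hZ1 : ∀ t, 0 ≤ t → |Z t| ≤ 1 := fun t ht => by
      have := h.mono o ht
      rw [abs_le]; constructor <;> linarith [hB t ht]
    refine ⟨fun t ht => ?_, fun T hT => M.nonper o h hZ1 hT⟩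
    have h1 := M.curve o h (a := 0) (b := t) (s := 0) (t := t) (fun y hy => hZ1 y hy.1) ⟨le_rfl, ht⟩ ⟨ht, le_rfl⟩
    rw [sub_zero] at h1
    rw [h1]
    exact ⟨o, _, _, hZ1 t ht, rfl⟩
  right
  push Not at hB
  obtain ⟨t, ht, hZt⟩ := hB
  have hc : Continuous Z := continuous_iff_continuousAt.2 (fun t => (h.dZ t).continuousAt)
  obtain ⟨t0, ht0, hz⟩ := intermediate_value_Icc ht hc.continuousOn (show (1:ℝ) ∈ Icc _ _ from ⟨hz0.2.le, hZt⟩)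
  have h00 := ht0.1
  have hZ1 : ∀ y ∈ Icc 0 t0, |Z y| ≤ 1 := fun y hy => by
    have a1 := h.mono o hy.1; have a2 := h.mono o hy.2
    rw [abs_le]; constructor <;> linarith
  have hcv : ∀ t ∈ Icc 0 t0, φ t (A + o.E (S 0) (Z 0)) = A + o.E (S t) (Z t) := by
    intro t ht
    have := M.curve o h (a := 0) (b := t0) (s := 0) (t := t) hZ1 ⟨le_rfl, by linarith⟩ ht
    rwa [sub_zero] at this
  refine ⟨t0, by linarith, fun t ht => ?_, S t0, ?_⟩
  · rw [hcv t ht]; exact ⟨o, _, _, hZ1 t ht, rfl⟩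
  · rw [hcv _ ⟨by linarith, le_rfl⟩, hz]

theorem core_bwd (M : Mod D v φ A) (o : Orb D) (s ζ : ℝ) (hζ : |ζ| < 1) :
    (∀ t, 0 ≤ t → InE D A (φ (-t) (A + o.E s ζ))) ∨
    ∃ T, 0 ≤ T ∧ (∀ t ∈ Icc 0 T, InE D A (φ (-t) (A + o.E s ζ))) ∧ ∃ s', φ (-T) (A + o.E s ζ) = A + o.E s' (-1) := by
  obtain ⟨S, Z, h, rfl, rfl⟩ := o.sol_ex s ζ
  have hz0 := abs_lt.1 hζ
  by_cases hB : ∀ t, 0 ≤ t → -1 < Z (-t)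
  · left
    have hZ1 : ∀ t, 0 ≤ t → |Z (-t)| ≤ 1 := fun t ht => by
      have := h.mono o (show -t ≤ 0 by linarith)
      rw [abs_le]; constructor <;> linarith [hB t ht]
    intro t ht
    have h1 := M.curve o h (a := -t) (b := 0) (s := 0) (t := -t) (fun y hy => by have := hZ1 (-y) (by linarith [hy.2]); rwa [neg_neg] at this) ⟨by linarith, le_rfl⟩ ⟨le_rfl, by linarith⟩
    rw [sub_zero] at h1
    rw [h1]
    exact ⟨o, _, _, hZ1 t ht, rfl⟩
  right
  push Not at hB
  obtain ⟨t, ht, hZt⟩ := hB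
  have hc : Continuous Z := continuous_iff_continuousAt.2 (fun t => (h.dZ t).continuousAt)
  obtain ⟨t0, ht0, hz⟩ := intermediate_value_Icc (show -t ≤ 0 by linarith) hc.continuousOn (show (-1:ℝ) ∈ Icc _ _ from ⟨hZt, hz0.1.le⟩)
  have h00 := ht0.2
  have hZ1 : ∀ y ∈ Icc t0 0, |Z y| ≤ 1 := fun y hy => by
    have a1 := h.mono o hy.1; have a2 := h.mono o hy.2
    rw [abs_le]; constructor <;> linarith
  have hcv : ∀ t ∈ Icc t0 0, φ t (A + o.E (S 0) (Z 0)) = A + o.E (S t) (Z t) := by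
    intro t ht
    have := M.curve o h (a := t0) (b := 0) (s := 0) (t := t) hZ1 ⟨by linarith, le_rfl⟩ ht
    rwa [sub_zero] at this
  refine ⟨-t0, by linarith, fun t ht => ?_, S t0, ?_⟩
  · have hm : -t ∈ Icc t0 0 := ⟨by linarith [ht.2], by linarith [ht.1]⟩
    rw [hcv _ hm]; exact ⟨o, _, _, hZ1 _ hm, rfl⟩
  · rw [neg_neg, hcv _ ⟨le_rfl, by linarith⟩, hz]

end Mod
end
end KR

open Set Filter Topology Metric
open scoped NNReal

namespace KR
noncomputable section

theorem trap_disc (D : DD) : ∃ (w0 : ℂ) (δ : ℝ), 0 < δ ∧ ∀ w : ℂ, ‖w - w0‖ < δ →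
    ∃ (o : Orb D) (s : ℝ), o.x 0 ∈ Icc D.a D.b ∧ -Real.pi < s ∧ ∀ ζ : ℝ, o.E s ζ = (w, ζ) := by
  have hp := Real.pi_gt_three
  set m : ℂ := (((D.a + D.b) / 2 : ℝ) : ℂ) + ((-2 : ℝ) : ℂ) * Complex.I with hm
  have him : m.im = -2 := by simp [hm]
  have hre : m.re = (D.a + D.b) / 2 := by simp [hm]
  have hlog : Complex.log (Complex.exp m) = m := Complex.log_exp (by rw [him]; linarith) (by rw [him]; linarith)
  have hsl : Complex.exp m ∈ Complex.slitPlane := by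
    rw [Complex.mem_slitPlane_iff]; right
    rw [Complex.exp_im, him, Real.sin_neg]
    have : 0 < Real.sin 2 := Real.sin_pos_of_pos_of_lt_pi (by norm_num) (by linarith)
    have := Real.exp_pos m.re
    nlinarith
  have hc := continuousAt_clog hsl
  have h1 : ∀ᶠ w in 𝓝 (Complex.exp m), (Complex.log w).re ∈ Ioo D.a D.b := by
    have := (Complex.continuous_re.continuousAt (x := Complex.log (Complex.exp m))).comp hc
    refine this.eventually (Ioo_mem_nhds ?_ ?_) <;> simp only [Function.comp, hlog, hre] <;> linarith [D.ab]
  have h2 : ∀ᶠ w in 𝓝 (Complex.exp m), (Complex.log w).im ∈ Ioo (-5/2 : ℝ) (-3/2) := by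
    have := (Complex.continuous_im.continuousAt (x := Complex.log (Complex.exp m))).comp hc
    refine this.eventually (Ioo_mem_nhds ?_ ?_) <;> simp only [Function.comp, hlog, him] <;> norm_num
  have h3 : ∀ᶠ w in 𝓝 (Complex.exp m), w ≠ 0 := isOpen_ne.mem_nhds (Complex.exp_ne_zero m)
  obtain ⟨δ, hδ, h⟩ := Metric.eventually_nhds_iff.1 ((h1.and h2).and h3)
  refine ⟨Complex.exp m, δ, hδ, fun w hw => ?_⟩
  obtain ⟨⟨k1, k2⟩, k3⟩ := h (show dist w _ < δ by rwa [dist_eq_norm])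
  obtain ⟨o, ho⟩ := Orb.ex D (Complex.log w).re (by linarith [D.a0, k1.1]) (by linarith [D.b1, k1.2])
  have hk := Orb.kp_zero (θ := (Complex.log w).im) (by linarith [k2.1]) (by linarith [k2.2])
  refine ⟨o, (Complex.log w).im, by rw [ho]; exact ⟨k1.1.le, k1.2.le⟩, by linarith [k2.1], fun ζ => ?_⟩
  have hb : bet (Complex.log w).im = 0 := bet_zero (by linarith [k2.2])
  have hu : bum (Complex.log w).im = 0 := bum_zero (by rw [abs_of_neg (by linarith [k2.2])]; linarith [k2.2])
  have hR : o.R (Complex.log w).im = (Complex.log w).re := by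
    unfold Orb.R lin; rw [hk.2, hb, hk.1, ho]; ring
  have hN : o.N (Complex.log w).im = 0 := by
    unfold Orb.N bmp; rw [hk.2, hu]; ring
  unfold Orb.E Orb.W
  rw [hR, hN, Complex.re_add_im, Complex.exp_log k3, zero_add]

theorem lattice (w0 : ℂ) {δ : ℝ} (hδ : 0 < δ) : ∃ (A : ℤ × ℤ × ℤ → V) (L : ℝ),
    (∀ a a' (p : V), ‖p.1 - (A a).1‖ < 3 → |p.2 - (A a).2| ≤ 5 → ‖p.1 - (A a').1‖ < 3 → |p.2 - (A a').2| ≤ 5 → a = a') ∧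
    ∀ (w : ℂ) (z : ℝ), ∃ a, ‖w - (A a).1 - w0‖ < δ ∧ z + 1 ≤ (A a).2 ∧ (A a).2 ≤ z + L := by
  set ρ : ℝ := δ / 2 with hρ
  have hρ0 : 0 < ρ := by positivity
  obtain ⟨N, hN⟩ := exists_nat_gt (7 / ρ)
  have hNρ : 7 < N * ρ := by rwa [div_lt_iff₀ hρ0] at hN
  have hN0 : (0:ℝ) < N := by
    by_contra hn
    nlinarith
  have hNZ : (0:ℤ) < N := by exact_mod_cast hN0
  refine ⟨fun a => (⟨ρ * a.1, ρ * a.2.1⟩, 12 * (a.1 + a.2.1 * N + a.2.2 * (N * N))), 12 * (N * N) + 1, ?_, ?_⟩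
  · rintro ⟨i, j, k⟩ ⟨i', j', k'⟩ ⟨w, z⟩ h1 h2 h3 h4
    simp only at h1 h2 h3 h4
    have small : ∀ n : ℤ, |ρ * (n : ℝ)| < 6 → ∀ m : ℤ, n = N * m → n = 0 := by
      intro n hn m hm
      by_contra h0
      have hm0 : m ≠ 0 := by rintro rfl; simp at hm; exact h0 hm
      have : (1:ℝ) ≤ |(m:ℝ)| := by exact_mod_cast Int.one_le_abs hm0
      rw [hm] at hn; push_cast at hn
      rw [abs_mul, abs_mul, abs_of_pos hρ0, abs_of_pos hN0] at hn
      nlinarith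
    have hnorm : ‖((⟨ρ * i, ρ * j⟩ : ℂ)) - ⟨ρ * i', ρ * j'⟩‖ < 6 := by
      have : ((⟨ρ * i, ρ * j⟩ : ℂ)) - ⟨ρ * i', ρ * j'⟩ = (w - ⟨ρ * i', ρ * j'⟩) - (w - ⟨ρ * i, ρ * j⟩) := by ring
      rw [this]
      exact lt_of_le_of_lt (norm_sub_le _ _) (by linarith)
    have hi : |ρ * ((i - i' : ℤ) : ℝ)| < 6 := by
      refine lt_of_le_of_lt ?_ hnorm
      refine le_trans (le_of_eq ?_) (Complex.abs_re_le_norm _)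
      simp only [Complex.sub_re, Complex.sub_im]; push_cast; rw [mul_sub]
    have hj : |ρ * ((j - j' : ℤ) : ℝ)| < 6 := by
      refine lt_of_le_of_lt ?_ hnorm
      refine le_trans (le_of_eq ?_) (Complex.abs_im_le_norm _)
      simp only [Complex.sub_re, Complex.sub_im]; push_cast; rw [mul_sub]
    have hz : (i - i') + (j - j') * N + (k - k') * (N * N) = 0 := by
      have h5 : |((((i - i') + (j - j') * N + (k - k') * (N * N) : ℤ)) : ℝ)| < 1 := by
        push_cast
        rw [abs_le] at h2 h4
        rw [abs_lt]; constructor <;> linarith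
      have h6 : |(i - i') + (j - j') * N + (k - k') * (N * N)| < 1 := by exact_mod_cast h5
      exact Int.abs_lt_one_iff.1 h6
    have ei := small _ hi (-((j - j') + (k - k') * N)) (by linear_combination hz)
    have e2 : (j - j') + (k - k') * N = 0 := by
      rw [ei] at hz
      have : N * ((j - j') + (k - k') * N) = 0 := by linear_combination hz
      exact (mul_eq_zero.1 this).resolve_left hNZ.ne'
    have ej := small _ hj (-(k - k')) (by linear_combination e2)
    have ek : k - k' = 0 := by
      rw [ej, zero_add] at e2
      exact (mul_eq_zero.1 e2).resolve_right hNZ.ne'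
    simp only [Prod.mk.injEq]; omega
  · intro w z
    set i : ℤ := round ((w - w0).re / ρ)
    set j : ℤ := round ((w - w0).im / ρ)
    have hi := abs_sub_round ((w - w0).re / ρ)
    have hj := abs_sub_round ((w - w0).im / ρ)
    have key : ∀ (x : ℝ) (n : ℤ), |x / ρ - n| ≤ 1/2 → |x - ρ * n| ≤ ρ / 2 := by
      intro x n h
      have : x - ρ * n = ρ * (x / ρ - n) := by field_simp
      rw [this, abs_mul, abs_of_pos hρ0]; nlinarith
    set y : ℝ := z + 1 - 12 * (i + j * N) with hy
    have hNN : (0:ℝ) < 12 * (N * N) := by positivity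
    have hk1 := Int.le_ceil (y / (12 * (N * N)))
    have hk2 := Int.ceil_lt_add_one (y / (12 * (N * N)))
    rw [div_le_iff₀ hNN] at hk1
    rw [← sub_lt_iff_lt_add, lt_div_iff₀ hNN] at hk2
    refine ⟨(i, j, ⌈y / (12 * (N * N))⌉), ?_, ?_, ?_⟩
    · refine lt_of_le_of_lt (Complex.norm_le_abs_re_add_abs_im _) ?_
      have a1 := key _ _ hi
      have a2 := key _ _ hj
      simp only [Complex.sub_re, Complex.sub_im] at a1 a2 ⊢
      have b1 : w.re - ρ * i - w0.re = w.re - w0.re - ρ * i := by ring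
      have b2 : w.im - ρ * j - w0.im = w.im - w0.im - ρ * j := by ring
      rw [b1, b2]
      simp only [i, j, Complex.sub_re, Complex.sub_im]
      linarith
    · simp only; linarith
    · simp only; linarith

theorem field (D : DD) {ι : Type} (A : ι → V)
    (sep : ∀ a a' (p : V), ‖p.1 - (A a).1‖ < 3 → |p.2 - (A a).2| ≤ 5 → ‖p.1 - (A a').1‖ < 3 → |p.2 - (A a').2| ≤ 5 → a = a') :
    ∃ (v : V → V) (φ : ℝ → V → V), (∀ a, Mod D v φ (A a)) ∧ IsFlowOf v φ ∧
      ∀ p, (∀ a, p - A a ∉ D.core0) → v p = (0, 1) := by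
  classical
  obtain ⟨K, hK⟩ := D.g_lip
  obtain ⟨M, hM⟩ := D.g_bdd
  set G : V → V := fun p => if h : ∃ a, p - A a ∈ D.core0 then D.g (p - A h.choose) else 0 with hG
  have sep' : ∀ a a' (p : V), ‖p.1 - (A a).1‖ < 3 → |p.2 - (A a).2| ≤ 5 → p - A a' ∈ D.core0 → a = a' := by
    intro a a' p h1 h2 h3
    have := D.core0_bd h3
    exact sep a a' p h1 h2 this.2.1 this.2.2.le
  have G1 : ∀ a (p : V), ‖p.1 - (A a).1‖ < 3 → |p.2 - (A a).2| ≤ 5 → G p = D.g (p - A a) := by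
    intro a p h1 h2
    by_cases h : ∃ a, p - A a ∈ D.core0
    · simp only [hG, dif_pos h]
      rw [← sep' a _ p h1 h2 h.choose_spec]
    · simp only [hG, dif_neg h]
      rw [D.g_zero (fun hc => h ⟨a, hc⟩)]
  have G2 : ∀ a p, p - A a ∈ D.core0 → G p = D.g (p - A a) := fun a p h => by
    have := D.core0_bd h
    exact G1 a p this.2.1 this.2.2.le
  have G0 : ∀ p, (∀ a, p - A a ∉ D.core0) → G p = 0 := fun p h => by
    simp only [hG]; rw [dif_neg]; push Not; exact h
  have Glip : ∀ x y, (∃ a, x - A a ∈ D.core0 ∧ y - A a ∈ D.core0) ∨ ‖G x‖ ≤ K * dist x y := by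
    intro x y
    by_cases h : ∃ a, x - A a ∈ D.core0
    · obtain ⟨a, ha⟩ := h
      by_cases hy : y - A a ∈ D.core0
      · exact Or.inl ⟨a, ha, hy⟩
      right
      have := hK.dist_le_mul (x - A a) (y - A a)
      rw [D.g_zero hy, ← G2 a x ha, dist_zero_right, dist_sub_right] at this
      exact this
    · right
      rw [G0 x (by push Not at h; exact h), norm_zero]; positivity
  have hlip : LipschitzWith (2 * K) G := by
    refine LipschitzWith.of_dist_le_mul (fun x y => ?_)
    push_cast
    have hd : 0 ≤ (K:ℝ) * dist x y := by positivity
    have hs : (∃ a, x - A a ∈ D.core0 ∧ y - A a ∈ D.core0) → dist (G x) (G y) ≤ 2 * K * dist x y := by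
      rintro ⟨a, h1, h2⟩
      rw [G2 a x h1, G2 a y h2]
      have := hK.dist_le_mul (x - A a) (y - A a)
      rw [dist_sub_right] at this
      linarith
    rcases Glip x y with h | h1
    · exact hs h
    rcases Glip y x with ⟨a, h, h'⟩ | h2
    · exact hs ⟨a, h', h⟩
    rw [dist_comm y x] at h2
    rw [dist_eq_norm (G x)]
    exact (norm_sub_le _ _).trans (by linarith)
  have hbd : ∀ p, ‖G p‖ ≤ M := fun p => by
    by_cases h : ∃ a, p - A a ∈ D.core0
    · simp only [hG, dif_pos h]; exact hM _
    · simp only [hG, dif_neg h]; simp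
  obtain ⟨φ, hφ⟩ := exists_flow (v := fun p => ((0:ℂ), (1:ℝ)) + G p) (K := 2 * K) (M := 1 + M)
    (by
      refine LipschitzWith.of_dist_le_mul (fun x y => ?_)
      rw [dist_add_left]; exact hlip.dist_le_mul x y)
    (fun p => (norm_add_le _ _).trans (by
      push_cast
      have : ‖((0:ℂ), (1:ℝ))‖ = 1 := by simp [Prod.norm_def]
      rw [this]; linarith [hbd p]))
  refine ⟨_, φ, fun a => ⟨hφ, fun p h1 h2 => ?_⟩, hφ, fun p hp => ?_⟩
  · rw [G1 a (A a + p) (by simpa using h1) (by simpa using h2), add_sub_cancel_left]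
  · rw [G0 p hp, add_zero]

/-- a global flow with model cells -/
structure Lat (D : DD) {ι : Type} (v : V → V) (φ : ℝ → V → V) (A : ι → V) (L : ℝ) : Prop where
  fl : IsFlowOf v φ
  M : ∀ a, Mod D v φ (A a)
  sep : ∀ a a' (p : V), ‖p.1 - (A a).1‖ < 3 → |p.2 - (A a).2| ≤ 5 → ‖p.1 - (A a').1‖ < 3 → |p.2 - (A a').2| ≤ 5 → a = a'
  off : ∀ p, (∀ a, p - A a ∉ D.core0) → v p = (0, 1)
  dense : ∀ (w : ℂ) (z : ℝ), ∃ (a : ι) (o : Orb D) (s : ℝ), o.x 0 ∈ Icc D.a D.b ∧ -Real.pi < s ∧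
    (∀ ζ : ℝ, A a + o.E s ζ = (w, (A a).2 + ζ)) ∧ z + 1 ≤ (A a).2 ∧ (A a).2 ≤ z + L

theorem exists_lat : ∃ (D : DD) (v : V → V) (φ : ℝ → V → V) (A : ℤ × ℤ × ℤ → V) (L : ℝ), Lat D v φ A L := by
  obtain ⟨D⟩ := exists_DD
  obtain ⟨w0, δ, hδ, h⟩ := trap_disc D
  obtain ⟨A, L, sep, dn⟩ := lattice w0 hδ
  obtain ⟨v, φ, h1, h2, h3⟩ := field D A sep
  refine ⟨D, v, φ, A, L, h2, h1, sep, h3, fun w z => ?_⟩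
  obtain ⟨a, ha, hz⟩ := dn w z
  obtain ⟨o, s, k1, k2, k3⟩ := h _ ha
  refine ⟨a, o, s, k1, k2, fun ζ => ?_, hz⟩
  rw [k3]; ext1 <;> simp

end
end KR

open Set Filter Topology Metric
open scoped NNReal

namespace KR
noncomputable section

/-- tall box about a vertical segment -/
def Bx (w : ℂ) (a b : ℝ) (p : V) : Prop := ‖p.1 - w‖ ≤ 6 ∧ a - 10 ≤ p.2 ∧ p.2 ≤ b + 10

theorem Bx.mono {w : ℂ} {a b a' b' : ℝ} {p : V} (h : Bx w a b p) (ha : a' ≤ a) (hb : b ≤ b') : Bx w a' b' p :=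
  ⟨h.1, by linarith [h.2.1], by linarith [h.2.2]⟩

theorem InE.bx {D : DD} {A p : V} {w : ℂ} {a b c : ℝ} (h : InE D A p) (h' : InE D A (w, c)) (ha : a ≤ c) (hb : c ≤ b) : Bx w a b p := by
  obtain ⟨h1, h2⟩ := h.bd
  obtain ⟨h3, h4⟩ := h'.bd
  simp only at h3 h4
  rw [abs_le] at h2 h4
  refine ⟨?_, by linarith, by linarith⟩
  have : p.1 - w = (p.1 - A.1) - (w - A.1) := by ring
  rw [this]
  exact (norm_sub_le _ _).trans (by linarith)

/-- passage -/
def Pass (φ : ℝ → V → V) (w : ℂ) (a b : ℝ) : Prop :=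
  ∃ T, 0 ≤ T ∧ φ T (w, a) = (w, b) ∧ ∀ t ∈ Icc 0 T, Bx w a b (φ t (w, a))

/-- trapping -/
def Trap (φ : ℝ → V → V) (w : ℂ) (a b : ℝ) : Prop :=
  (∀ t, 0 ≤ t → Bx w a b (φ t (w, a))) ∧ (∀ t, 0 ≤ t → Bx w a b (φ (-t) (w, b))) ∧ ∀ T, 0 < T → φ T (w, a) ≠ (w, a)

def Seg (φ : ℝ → V → V) (w : ℂ) (a b : ℝ) : Prop := Pass φ w a b ∨ Trap φ w a b

section
variable {v : V → V} {φ : ℝ → V → V} {w : ℂ} {a b c : ℝ}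

theorem Pass.bwd (hf : IsFlowOf v φ) (h : Pass φ w a b) : ∃ T, 0 ≤ T ∧ φ (-T) (w, b) = (w, a) ∧ ∀ t ∈ Icc 0 T, Bx w a b (φ (-t) (w, b)) := by
  obtain ⟨T, h0, h1, h2⟩ := h
  refine ⟨T, h0, by rw [← h1, hf.neg_apply], fun t ht => ?_⟩
  have : φ (-t) (w, b) = φ (T - t) (w, a) := by
    rw [← h1, ← hf.add]; congr 1; ring
  rw [this]
  exact h2 _ ⟨by linarith [ht.2], by linarith [ht.1]⟩

theorem Pass.trans (hf : IsFlowOf v φ) (h : Pass φ w a b) (h' : Pass φ w b c) (hab : a ≤ b) (hbc : b ≤ c) : Pass φ w a c := by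
  obtain ⟨T, h0, h1, h2⟩ := h
  obtain ⟨T', k0, k1, k2⟩ := h'
  refine ⟨T' + T, by linarith, by rw [hf.add, h1, k1], fun t ht => ?_⟩
  rcases le_total t T with h | h
  · exact (h2 t ⟨ht.1, h⟩).mono le_rfl hbc
  · have : φ t (w, a) = φ (t - T) (w, b) := by
      rw [← h1, ← hf.add]; congr 1; ring
    rw [this]
    exact (k2 _ ⟨by linarith, by linarith [ht.2]⟩).mono hab le_rfl

theorem Trap.seg (hf : IsFlowOf v φ) (h : Trap φ w a b) (h' : Seg φ w b c) (hab : a ≤ b) (hbc : b ≤ c) : Trap φ w a c := by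
  refine ⟨fun t ht => (h.1 t ht).mono le_rfl hbc, fun t ht => ?_, h.2.2⟩
  rcases h' with h' | h'
  · obtain ⟨T, k0, k1, k2⟩ := h'.bwd hf
    rcases le_total t T with hT | hT
    · exact (k2 t ⟨ht, hT⟩).mono hab le_rfl
    · have : φ (-t) (w, c) = φ (-(t - T)) (w, b) := by
        rw [← k1, ← hf.add]; congr 1; ring
      rw [this]
      exact (h.2.1 _ (by linarith)).mono le_rfl hbc
  · exact (h'.2.1 t ht).mono hab le_rfl

theorem Seg.trap (hf : IsFlowOf v φ) (h : Seg φ w a b) (h' : Trap φ w b c) (hab : a ≤ b) (hbc : b ≤ c) : Trap φ w a c := by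
  rcases h with h | h
  · obtain ⟨T, k0, k1, k2⟩ := h
    refine ⟨fun t ht => ?_, fun t ht => (h'.2.1 t ht).mono hab le_rfl, fun S hS he => ?_⟩
    · rcases le_total t T with hT | hT
      · exact (k2 t ⟨ht, hT⟩).mono le_rfl hbc
      · have : φ t (w, a) = φ (t - T) (w, b) := by
          rw [← k1, ← hf.add]; congr 1; ring
        rw [this]
        exact (h'.1 _ (by linarith)).mono hab le_rfl
    · refine h'.2.2 S hS ?_
      rw [← k1, ← hf.add, add_comm, hf.add, he]
  · exact h.seg hf (Or.inr h') hab hbc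

theorem Seg.trans (hf : IsFlowOf v φ) (h : Seg φ w a b) (h' : Seg φ w b c) (hab : a ≤ b) (hbc : b ≤ c) : Seg φ w a c := by
  rcases h' with h' | h'
  · rcases h with h | h
    · exact Or.inl (h.trans hf h' hab hbc)
    · exact Or.inr (h.seg hf (Or.inl h') hab hbc)
  · exact Or.inr (h.trap hf h' hab hbc)

end

namespace Lat
variable {D : DD} {ι : Type} {v : V → V} {φ : ℝ → V → V} {A : ι → V} {L : ℝ}

/-- non-core points -/
def NC (D : DD) (A : ι → V) (p : V) : Prop := ∀ a, p - A a ∉ D.core0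

theorem nc_end (H : Lat D v φ A L) (a : ι) (o : Orb D) (s : ℝ) {ζ : ℝ} (hζ : |ζ| = 1) : NC D A (A a + o.E s ζ) := by
  intro a' hc
  have h1 : InE D (A a) (A a + o.E s ζ) := ⟨o, s, ζ, hζ.le, rfl⟩
  have h2 := h1.bd
  have h3 := D.core0_bd hc
  have := H.sep a a' _ h2.1 h2.2 h3.2.1 h3.2.2.le
  subst this
  rw [add_sub_cancel_left, o.E_core hζ.le] at hc
  linarith [hc.2]

theorem caseB_trap {a : ι} {w : ℂ} {c : ℝ} {o : Orb D} {s : ℝ} (hE : ∀ η, A a + o.E s η = (w, c + η))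
    (h : Mod.CaseB D φ (A a) (A a + o.E s (-1)) (A a + o.E s 1)) : Trap φ w (c - 1) (c + 1) := by
  have i0 : InE D (A a) (w, c + 0) := ⟨o, s, 0, by simp, (hE 0).symm⟩
  obtain ⟨h1, h2, h3⟩ := h
  rw [hE] at h1 h2 h3
  exact ⟨fun t ht => (h1 t ht).bx i0 (by linarith) (by linarith), fun t ht => (h2 t ht).bx i0 (by linarith) (by linarith), h3⟩

theorem cell (H : Lat D v φ A L) {a : ι} {w : ℂ} {c : ℝ} {o : Orb D} {s : ℝ} (hE : ∀ η, A a + o.E s η = (w, c + η)) : Seg φ w (c - 1) (c + 1) := by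
  have i0 : InE D (A a) (w, c + 0) := ⟨o, s, 0, by simp, (hE 0).symm⟩
  rcases (H.M a).cases o s with ⟨T, h0, h1, h2⟩ | h
  · left
    rw [hE, hE] at h1
    rw [hE] at h2
    exact ⟨T, h0, h1, fun t ht => (h2 t ht).bx i0 (by linarith) (by linarith)⟩
  · exact Or.inr (caseB_trap hE h)

theorem vert (H : Lat D v φ A L) {w : ℂ} {a b : ℝ} (hab : a ≤ b) (h : ∀ z ∈ Icc a b, NC D A (w, z)) : Seg φ w a b := by
  have key : ∀ t ∈ Icc 0 (b - a), φ t (w, a) = (w, a + t) := by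
    intro t ht
    have := H.fl.eq_of_forall (γ := fun t => ((w, a + t) : V)) (a := 0) (b := b - a) (s := 0) (t := t) (fun y hy => by
      rw [H.off _ (h (a + y) ⟨by linarith [hy.1], by linarith [hy.2]⟩)]
      exact (hasDerivAt_const y w).prodMk ((hasDerivAt_id y).const_add a)) ⟨le_rfl, by linarith⟩ ht
    simp only [sub_zero, add_zero] at this
    exact this.symm
  left
  refine ⟨b - a, by linarith, by rw [key _ ⟨by linarith, le_rfl⟩]; simp, fun t ht => ?_⟩
  rw [key t ht]
  refine ⟨by simp, by simp only; linarith [ht.1], by simp only; linarith [ht.2]⟩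

theorem seg_aux (H : Lat D v φ A L) (w : ℂ) (n : ℕ) : ∀ a b : ℝ, a ≤ b → b - a < n → NC D A (w, a) → NC D A (w, b) → Seg φ w a b := by
  induction n with
  | zero => intro a b h1 h2; simp at h2; linarith
  | succ n ih =>
    intro a b hab hn ha hb
    push_cast at hn
    by_cases hc : ∀ z ∈ Icc a b, NC D A (w, z)
    · exact H.vert hab hc
    unfold NC at hc
    push Not at hc
    obtain ⟨z, hz, i, hi⟩ := hc
    obtain ⟨o, s, ζ, h1, h2, h3⟩ := Orb.core_ex hi
    have hE : ∀ η, A i + o.E s η = (w, (z - ζ) + η) := by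
      intro η
      have e1 : w - (A i).1 = o.W s := congrArg Prod.fst h1
      have e2 : z - (A i).2 = o.N s + ζ := congrArg Prod.snd h1
      ext1
      · show (A i).1 + o.W s = w
        rw [← e1]; ring
      · show (A i).2 + (o.N s + η) = z - ζ + η
        linarith
    have hin : ∀ y, |y - (z - ζ)| < 1 → ¬ NC D A (w, y) := by
      intro y hy hnc
      have := hE (y - (z - ζ))
      rw [add_sub_cancel] at this
      refine hnc i ?_
      rw [← this, add_sub_cancel_left, o.E_core hy.le]
      exact ⟨h2, hy⟩
    have h3' := abs_lt.1 h3
    have ha1 : a ≤ z - ζ - 1 := by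
      by_contra hlt
      exact hin a (abs_lt.2 ⟨by linarith, by linarith [hz.1]⟩) ha
    have hb1 : z - ζ + 1 ≤ b := by
      by_contra hlt
      exact hin b (abs_lt.2 ⟨by linarith [hz.2], by linarith⟩) hb
    have n1 : NC D A (w, z - ζ - 1) := by
      have := H.nc_end i o s (ζ := -1) (by norm_num)
      rwa [hE] at this
    have n2 : NC D A (w, z - ζ + 1) := by
      have := H.nc_end i o s (ζ := 1) (by norm_num)
      rwa [hE] at this
    have s1 := ih a (z - ζ - 1) ha1 (by linarith) ha n1
    have s2 := H.cell hE
    have s3 := ih (z - ζ + 1) b hb1 (by linarith) n2 hb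
    exact (s1.trans H.fl s2 ha1 (by linarith)).trans H.fl s3 (by linarith) hb1

theorem seg (H : Lat D v φ A L) {w : ℂ} {a b : ℝ} (hab : a ≤ b) (ha : NC D A (w, a)) (hb : NC D A (w, b)) : Seg φ w a b := by
  obtain ⟨n, hn⟩ := exists_nat_gt (b - a)
  exact H.seg_aux w n a b hab hn ha hb

/-- traps on each vertical line -/
theorem traps (H : Lat D v φ A L) (w : ℂ) (z : ℝ) : ∃ c, z + 1 ≤ c ∧ c ≤ z + L ∧ Trap φ w (c - 1) (c + 1) ∧ NC D A (w, c - 1) ∧ NC D A (w, c + 1) := by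
  obtain ⟨a, o, s, h1, h2, h3, h4, h5⟩ := H.dense w z
  refine ⟨(A a).2, h4, h5, caseB_trap h3 ((H.M a).trap o h1 s h2), ?_, ?_⟩
  · have := H.nc_end a o s (ζ := -1) (by norm_num)
    rwa [h3] at this
  · have := H.nc_end a o s (ζ := 1) (by norm_num)
    rwa [h3] at this

theorem Lpos (H : Lat D v φ A L) : 1 ≤ L := by
  obtain ⟨c, h1, h2, _⟩ := H.traps 0 0
  linarith

theorem nc_fwd (H : Lat D v φ A L) {p : V} (hp : NC D A p) : (∀ t, 0 ≤ t → ‖φ t p - p‖ ≤ L + 11) ∧ ∀ T, 0 < T → φ T p ≠ p := by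
  obtain ⟨w, z⟩ := p
  have hL := H.Lpos
  obtain ⟨c, h1, h2, h3, h4, h5⟩ := H.traps w z
  have h := (H.seg (by linarith) hp h4).trap H.fl h3 (by linarith) (by linarith)
  refine ⟨fun t ht => ?_, h.2.2⟩
  obtain ⟨k1, k2, k3⟩ := h.1 t ht
  rw [Prod.norm_def]
  refine max_le ?_ ?_
  · simp only [Prod.fst_sub]; linarith
  · simp only [Prod.snd_sub, Real.norm_eq_abs, abs_le]; constructor <;> linarith

theorem nc_bwd (H : Lat D v φ A L) {p : V} (hp : NC D A p) : ∀ t, 0 ≤ t → ‖φ (-t) p - p‖ ≤ L + 11 := by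
  obtain ⟨w, z⟩ := p
  have hL := H.Lpos
  obtain ⟨c, h1, h2, h3, h4, h5⟩ := H.traps w (z - L - 1)
  have h := h3.seg H.fl (H.seg (by linarith) h5 hp) (by linarith) (by linarith)
  intro t ht
  obtain ⟨k1, k2, k3⟩ := h.2.1 t ht
  rw [Prod.norm_def]
  refine max_le ?_ ?_
  · simp only [Prod.fst_sub]; linarith
  · simp only [Prod.snd_sub, Real.norm_eq_abs, abs_le]; constructor <;> linarith

theorem InE_dist {A p q : V} (hp : InE D A p) (hq : InE D A q) : ‖p - q‖ ≤ 10 := by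
  have h := hp.bx (w := q.1) (c := q.2) (a := q.2) (b := q.2) hq le_rfl le_rfl
  rw [Prod.norm_def]
  refine max_le ?_ ?_
  · simp only [Prod.fst_sub]; linarith [h.1]
  · simp only [Prod.snd_sub, Real.norm_eq_abs, abs_le]; constructor <;> linarith [h.2.1, h.2.2]

theorem core_of {p : V} (hp : ¬ NC D A p) : ∃ (a : ι) (o : Orb D) (s ζ : ℝ), p = A a + o.E s ζ ∧ |ζ| < 1 := by
  unfold NC at hp
  push Not at hp
  obtain ⟨a, ha⟩ := hp
  obtain ⟨o, s, ζ, h1, h2, h3⟩ := Orb.core_ex ha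
  exact ⟨a, o, s, ζ, by rw [← h1]; abel, h3⟩

theorem fwd (H : Lat D v φ A L) (p : V) : (∀ t, 0 ≤ t → ‖φ t p - p‖ ≤ L + 21) ∧ ∀ T, 0 < T → φ T p ≠ p := by
  have hL := H.Lpos
  by_cases hp : NC D A p
  · obtain ⟨h1, h2⟩ := H.nc_fwd hp
    exact ⟨fun t ht => (h1 t ht).trans (by linarith), h2⟩
  obtain ⟨a, o, s, ζ, rfl, hζ⟩ := core_of hp
  have ip : InE D (A a) (A a + o.E s ζ) := ⟨o, s, ζ, hζ.le, rfl⟩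
  rcases (H.M a).core_fwd o s ζ hζ with ⟨h1, h2⟩ | ⟨T, h0, h1, s', h2⟩
  · exact ⟨fun t ht => (InE_dist (h1 t ht) ip).trans (by linarith), h2⟩
  · obtain ⟨k1, k2⟩ := H.nc_fwd (H.nc_end a o s' (ζ := 1) (by norm_num))
    rw [← h2] at k1 k2
    refine ⟨fun t ht => ?_, fun S hS he => ?_⟩
    · rcases le_total t T with hT | hT
      · exact (InE_dist (h1 t ⟨ht, hT⟩) ip).trans (by linarith)
      · have e1 := k1 (t - T) (by linarith)
        rw [← H.fl.add, sub_add_cancel] at e1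
        have e2 := InE_dist (h1 T ⟨h0, le_rfl⟩) ip
        calc _ ≤ _ := norm_sub_le_norm_sub_add_norm_sub _ (φ T (A a + o.E s ζ)) _
          _ ≤ _ := by linarith
    · refine k2 S hS ?_
      rw [← H.fl.add, add_comm, H.fl.add, he]

theorem bwd (H : Lat D v φ A L) (p : V) : ∀ t, 0 ≤ t → ‖φ (-t) p - p‖ ≤ L + 21 := by
  have hL := H.Lpos
  by_cases hp : NC D A p
  · exact fun t ht => (H.nc_bwd hp t ht).trans (by linarith)
  obtain ⟨a, o, s, ζ, rfl, hζ⟩ := core_of hp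
  have ip : InE D (A a) (A a + o.E s ζ) := ⟨o, s, ζ, hζ.le, rfl⟩
  rcases (H.M a).core_bwd o s ζ hζ with h1 | ⟨T, h0, h1, s', h2⟩
  · exact fun t ht => (InE_dist (h1 t ht) ip).trans (by linarith)
  · have k1 := H.nc_bwd (H.nc_end a o s' (ζ := -1) (by norm_num))
    rw [← h2] at k1
    intro t ht
    rcases le_total t T with hT | hT
    · exact (InE_dist (h1 t ⟨ht, hT⟩) ip).trans (by linarith)
    · have e1 := k1 (t - T) (by linarith)
      rw [← H.fl.add, show -(t - T) + -T = -t by ring] at e1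
      have e2 := InE_dist (h1 T ⟨h0, le_rfl⟩) ip
      calc _ ≤ _ := norm_sub_le_norm_sub_add_norm_sub _ (φ (-T) (A a + o.E s ζ)) _
        _ ≤ _ := by linarith

end Lat

theorem main_V : ∃ (v : V → V) (φ : ℝ → V → V) (K : ℝ), 0 < K ∧ IsFlowOf v φ ∧ (∀ t p, ‖φ t p - p‖ ≤ K) ∧ ∀ p T, T ≠ 0 → φ T p ≠ p := by
  obtain ⟨D, v, φ, A, L, H⟩ := exists_lat
  refine ⟨v, φ, L + 21, by linarith [H.Lpos], H.fl, fun t p => ?_, fun p T hT he => ?_⟩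
  · rcases le_total 0 t with h | h
    · exact (H.fwd p).1 t h
    · have := H.bwd p (-t) (by linarith)
      rwa [neg_neg] at this
  · rcases lt_or_gt_of_ne hT with h | h
    · refine (H.fwd p).2 (-T) (by linarith) ?_
      conv_lhs => rw [← he]
      exact H.fl.neg_apply _ _
    · exact (H.fwd p).2 T h he

theorem main_E : ∃ φ : ℝ × EuclideanSpace ℝ (Fin 3) → EuclideanSpace ℝ (Fin 3), Continuous φ ∧ (∀ x, φ (0, x) = x) ∧
    (∀ s t x, φ (s + t, x) = φ (s, φ (t, x))) ∧ (∀ x T, T ≠ 0 → φ (T, x) ≠ x) ∧ ∃ K : ℝ, 0 < K ∧ ∀ t x, ‖φ (t, x) - x‖ ≤ K := by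
  obtain ⟨v, φ, K, hK, hf, hb, hn⟩ := main_V
  have hd : Module.finrank ℝ V = Module.finrank ℝ (EuclideanSpace ℝ (Fin 3)) := by
    simp [V, Module.finrank_prod]
  let e : V ≃L[ℝ] EuclideanSpace ℝ (Fin 3) := ContinuousLinearEquiv.ofFinrankEq hd
  refine ⟨fun p => e (φ p.1 (e.symm p.2)), ?_, fun x => ?_, fun s t x => ?_, fun x T hT he => ?_, (‖(e : V →L[ℝ] EuclideanSpace ℝ (Fin 3))‖ + 1) * K, by positivity, fun t x => ?_⟩
  · exact e.continuous.comp (hf.cont.comp (continuous_fst.prodMk (e.symm.continuous.comp continuous_snd)))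
  · simp [hf.zero]
  · simp [hf.add]
  · refine hn (e.symm x) T hT ?_
    simp only at he
    exact (e.eq_symm_apply).2 he
  · have h1 : e (φ t (e.symm x)) - x = (e : V →L[ℝ] EuclideanSpace ℝ (Fin 3)) (φ t (e.symm x) - e.symm x) := by simp
    simp only
    rw [h1]
    refine ((e : V →L[ℝ] EuclideanSpace ℝ (Fin 3)).le_opNorm _).trans ?_
    have := hb t (e.symm x)
    have h3 := norm_nonneg (e : V →L[ℝ] EuclideanSpace ℝ (Fin 3))
    nlinarith [norm_nonneg (φ t (e.symm x) - e.symm x)]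

end
end KR


/-- **Kuperberg–Reed (1989).** There exists a flow on `ℝ³` with uniformly bounded
trajectories and no compact trajectories: no rest points and no periodic orbits. -/
theorem kuperberg_reed_bounded_flow_no_compact_trajectories :
    ∃ φ : ℝ × EuclideanSpace ℝ (Fin 3) → EuclideanSpace ℝ (Fin 3),
      Continuous φ ∧
      (∀ x : EuclideanSpace ℝ (Fin 3), φ (0, x) = x) ∧
      (∀ s t : ℝ, ∀ x : EuclideanSpace ℝ (Fin 3), φ (s + t, x) = φ (s, φ (t, x))) ∧
      (∀ x : EuclideanSpace ℝ (Fin 3), ∀ T : ℝ, T ≠ 0 → φ (T, x) ≠ x) ∧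
      (∃ K : ℝ, 0 < K ∧ ∀ t : ℝ, ∀ x : EuclideanSpace ℝ (Fin 3), ‖φ (t, x) - x‖ ≤ K) :=
  KR.main_E
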